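/- Let 𝒦 be a locally small category with finite products. Then the free colimit completion 𝒫𝒦 is cartesian closed if and only if 𝒦 is pre-complete and cartesian pre-closed. -/

import Mathlib

/- Common definitions for formalizing "How nice are free completions of categories?"
   by Adámek and Rosický. -/

open CategoryTheory CategoryTheory.Limits

universe w w₁ w₂ v₁ u₁

namespace FreeCompletions

/-- A presheaf is *small* if it is a colimit of representables over a small
(`Type w`-indexed) diagram. -/
def IsSmallPresheaf {C : Type u₁} [Category.{v₁} C] (F : Cᵒᵖ ⥤ Type v₁) : Prop :=
  ∃ (J : Type w) (_ : SmallCategory J) (D : J ⥤ C) (c : Cocone (D ⋙ yoneda)),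
    Nonempty (IsColimit c) ∧ Nonempty (c.pt ≅ F)

/-- A presheaf is a (small) coproduct of representables. -/
def IsCoproductOfRepresentables {C : Type u₁} [Category.{v₁} C] (F : Cᵒᵖ ⥤ Type v₁) : Prop :=
  ∃ (I : Type v₁) (A : I → C), Nonempty (F ≅ ∐ fun i => yoneda.obj (A i))

/-- The free coproduct completion `Σ𝒦`, realized as the full subcategory of presheaves
consisting of coproducts of representables. -/
abbrev SigmaCompletion (K : Type u₁) [Category.{v₁} K] :=
  ObjectProperty.FullSubcategory (IsCoproductOfRepresentables (C := K))

/-- The free colimit completion `𝒫𝒦`, the full subcategory of presheaves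
consisting of the small presheaves. -/
abbrev PCompletion (K : Type u₁) [Category.{v₁} K] :=
  ObjectProperty.FullSubcategory (IsSmallPresheaf.{v₁} (C := K))

/-- The object of `Σ𝒦` given by a small family of objects of `𝒦`. -/
noncomputable def famObj {K : Type u₁} [Category.{v₁} K] {I : Type v₁} (B : I → K) :
    SigmaCompletion K :=
  ⟨∐ fun i => yoneda.obj (B i), ⟨I, B, ⟨Iso.refl _⟩⟩⟩

theorem isSmallPresheaf_coprod {K : Type u₁} [Category.{v₁} K] {I : Type v₁} (B : I → K) :
    IsSmallPresheaf.{v₁} (∐ fun i => yoneda.obj (B i)) := by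
  let G := Discrete.functor (fun i => yoneda.obj (B i))
  let e : Discrete.functor B ⋙ yoneda ≅ G := Discrete.natIso (fun i => Iso.refl _)
  exact ⟨Discrete I, inferInstance, Discrete.functor B,
    (Cocone.precompose e.hom).obj (colimit.cocone G),
    ⟨(IsColimit.precomposeHomEquiv e (colimit.cocone G)).symm (colimit.isColimit G)⟩,
    ⟨Iso.refl _⟩⟩

/-- The object of `𝒫𝒦` given by a small coproduct of representables. -/
noncomputable def pcoprodObj {K : Type u₁} [Category.{v₁} K] {I : Type v₁} (B : I → K) :
    PCompletion K :=
  ⟨∐ fun i => yoneda.obj (B i), isSmallPresheaf_coprod B⟩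

/-- A diagram `D` has a *multi-limit*: a set of cones through which every cone
factorizes uniquely (unique member and unique factorization). -/
def HasMultiLimit {J : Type w₁} [Category.{w₂} J] {C : Type u₁} [Category.{v₁} C]
    (D : J ⥤ C) : Prop :=
  ∃ (T : Type w) (c : T → Cone D), ∀ s : Cone D,
    ∃ p : Σ t : T, s ⟶ c t, ∀ q : Σ t : T, s ⟶ c t, q = p

/-- `𝒦` is finitely multi-complete: every finite diagram has a multi-limit. -/
def FinitelyMultiComplete (C : Type u₁) [Category.{v₁} C] : Prop :=
  ∀ (J : Type) [SmallCategory J] [FinCategory J] (D : J ⥤ C), HasMultiLimit.{v₁} D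

/-- A family `A : I → C` has a *multi-product*: a set of cones through which every cone
factorizes uniquely (unique member and unique factorization). -/
def HasMultiProduct {C : Type u₁} [Category.{v₁} C] {I : Type w₁} (A : I → C) : Prop :=
  ∃ (T : Type w) (P : T → C) (π : ∀ t i, P t ⟶ A i),
    ∀ (X : C) (f : ∀ i, X ⟶ A i),
      ∃ p : Σ t : T, X ⟶ P t, (∀ i, p.2 ≫ π p.1 i = f i) ∧
        ∀ q : Σ t : T, X ⟶ P t, (∀ i, q.2 ≫ π q.1 i = f i) → q = p

/-- `C` has multi-products of all set-indexed families. -/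
def HasMultiProducts (C : Type u₁) [Category.{v₁} C] : Prop :=
  ∀ (I : Type v₁) (A : I → C), HasMultiProduct.{v₁} A

/-- A diagram `D` has a *pre-limit*: a set of cones through which every cone
factorizes (not necessarily uniquely). -/
def HasPreLimit {J : Type w₁} [Category.{w₂} J] {C : Type u₁} [Category.{v₁} C]
    (D : J ⥤ C) : Prop :=
  ∃ (T : Type w) (c : T → Cone D), ∀ s : Cone D, ∃ t : T, Nonempty (s ⟶ c t)

/-- `C` is pre-complete: every small diagram has a pre-limit. -/
def PreComplete (C : Type u₁) [Category.{v₁} C] : Prop :=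
  ∀ (J : Type v₁) [SmallCategory J] (D : J ⥤ C), HasPreLimit.{v₁} D

/-- `C` is finitely pre-complete: every finite diagram has a pre-limit. -/
def FinitelyPreComplete (C : Type u₁) [Category.{v₁} C] : Prop :=
  ∀ (J : Type) [SmallCategory J] [FinCategory J] (D : J ⥤ C), HasPreLimit.{v₁} D

/-- A family `A : I → C` has a *pre-product*: a set of cones through which every cone
factorizes (not necessarily uniquely). -/
def HasPreProduct {C : Type u₁} [Category.{v₁} C] {I : Type w₁} (A : I → C) : Prop :=
  ∃ (T : Type w) (P : T → C) (π : ∀ t i, P t ⟶ A i),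
    ∀ (X : C) (f : ∀ i, X ⟶ A i), ∃ (t : T) (h : X ⟶ P t), ∀ i, h ≫ π t i = f i

/-- `C` (with finite products) is cartesian multi-closed: each functor `A × -` is a
left multi-adjoint. -/
def CartesianMultiClosedOf (C : Type u₁) [Category.{v₁} C] [HasFiniteProducts C] : Prop :=
  ∀ A B : C, ∃ (I : Type v₁) (E : I → C) (ev : ∀ i, A ⨯ E i ⟶ B),
    ∀ (X : C) (c : A ⨯ X ⟶ B),
      ∃ p : Σ i : I, X ⟶ E i, (prod.map (𝟙 A) p.2 ≫ ev p.1 = c) ∧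
        ∀ q : Σ i : I, X ⟶ E i, prod.map (𝟙 A) q.2 ≫ ev q.1 = c → q = p

/-- `C` is cartesian multi-closed: it has finite products and each functor `A × -` is a
left multi-adjoint. -/
def CartesianMultiClosed (C : Type u₁) [Category.{v₁} C] : Prop :=
  ∃ h : HasFiniteProducts C, @CartesianMultiClosedOf C _ h

/-- `C` is cartesian closed (as a property: it has finite products and each `A × -`
is a left adjoint). -/
def CartesianClosedP (C : Type u₁) [Category.{v₁} C] : Prop :=
  ∃ h : CartesianMonoidalCategory C, Nonempty (@MonoidalClosed C _ h.toMonoidalCategory)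

/-- `C` is locally cartesian closed: every slice category is cartesian closed. -/
def LocallyCartesianClosedP (C : Type u₁) [Category.{v₁} C] : Prop :=
  ∀ A : C, CartesianClosedP (Over A)

/-- `C` is locally cartesian multi-closed: every slice category is cartesian multi-closed. -/
def LocallyCartesianMultiClosed (C : Type u₁) [Category.{v₁} C] : Prop :=
  ∀ A : C, CartesianMultiClosed (Over A)

/-- `C` (with finite products) is cartesian pre-closed: each functor `C(A × -, B)`
is a small presheaf. -/
def CartesianPreClosedOf (C : Type u₁) [Category.{v₁} C] [HasFiniteProducts C] : Prop :=
  ∀ A B : C, IsSmallPresheaf.{w} ((prod.functor.obj A).op ⋙ yoneda.obj B)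

/-- `C` is cartesian pre-closed: it has finite products and each functor `C(A × -, B)`
is a small presheaf. -/
def CartesianPreClosed (C : Type u₁) [Category.{v₁} C] : Prop :=
  ∃ h : HasFiniteProducts C, @CartesianPreClosedOf.{w} C _ h

/-- `C` (with binary products) has weak simple products. -/
def HasWeakSimpleProductsOf (C : Type u₁) [Category.{v₁} C] [HasBinaryProducts C] : Prop :=
  ∀ (A X B : C) (b : B ⟶ A ⨯ X),
    ∃ (P : C) (ε : A ⨯ P ⟶ B) (w : P ⟶ X),
      ε ≫ b = prod.map (𝟙 A) w ∧
      ∀ (P' : C) (ε' : A ⨯ P' ⟶ B) (w' : P' ⟶ X), ε' ≫ b = prod.map (𝟙 A) w' →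
        ∃ f : P' ⟶ P, ε' = prod.map (𝟙 A) f ≫ ε ∧ w' = f ≫ w

/-- `C` has binary products and weak simple products. -/
def HasWeakSimpleProducts (C : Type u₁) [Category.{v₁} C] : Prop :=
  ∃ h : HasBinaryProducts C, @HasWeakSimpleProductsOf C _ h

/-- `C` has a subobject classifier: a mono `ε : 1 ⟶ Ω` from the terminal object such that
every monomorphism is a pullback of `ε` along a unique morphism. -/
def HasSubobjectClassifierP (C : Type u₁) [Category.{v₁} C] : Prop :=
  ∃ (T Ω : C) (hT : IsTerminal T) (ε : T ⟶ Ω), Mono ε ∧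
    ∀ ⦃U X : C⦄ (m : U ⟶ X), Mono m → ∃! χ : X ⟶ Ω, IsPullback (hT.from U) m ε χ

/-- `C` is an elementary topos: finitely complete, cartesian closed,
with a subobject classifier. -/
def IsElementaryTopos (C : Type u₁) [Category.{v₁} C] : Prop :=
  HasFiniteLimits C ∧ CartesianClosedP C ∧ HasSubobjectClassifierP C

/-- `C` is a multi-topos: finitely complete, cartesian multi-closed,
with a subobject classifier. -/
def IsMultiTopos (C : Type u₁) [Category.{v₁} C] : Prop :=
  HasFiniteLimits C ∧ CartesianMultiClosed C ∧ HasSubobjectClassifierP C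

/-- A coproduct cocone is *universal*: it is stable under pullback. -/
def CofanUniversal {C : Type u₁} [Category.{v₁} C] {I : Type w₁} {X : I → C}
    (c : Cofan X) : Prop :=
  ∀ {W : C} (h : W ⟶ c.pt) (Y : I → C) (p : ∀ i, Y i ⟶ W) (q : ∀ i, Y i ⟶ X i),
    (∀ i, IsPullback (p i) (q i) h (c.inj i)) → Nonempty (IsColimit (Cofan.mk W p))

/-- A coproduct cocone is *disjoint*: injections are monic with initial pairwise
intersections. -/
def CofanDisjoint {C : Type u₁} [Category.{v₁} C] {I : Type w₁} {X : I → C}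
    (c : Cofan X) : Prop :=
  (∀ i, Mono (c.inj i)) ∧
    ∀ i j, i ≠ j → ∀ {Z : C} (u : Z ⟶ X i) (v : Z ⟶ X j),
      IsPullback u v (c.inj i) (c.inj j) → Nonempty (IsInitial Z)

/-- `C` is extensive: finitely complete, with finite coproducts which are
universal and disjoint. -/
def IsExtensive (C : Type u₁) [Category.{v₁} C] : Prop :=
  HasFiniteLimits C ∧ HasFiniteCoproducts C ∧
    ∀ (I : Type) [Finite I] (X : I → C) (c : Cofan X),
      Nonempty (IsColimit c) → CofanUniversal c ∧ CofanDisjoint c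

/-- `C` is infinitary extensive: finitely complete, with small (`Type w`-indexed)
coproducts which are universal and disjoint. -/
def IsInfinitaryExtensive (C : Type u₁) [Category.{v₁} C] : Prop :=
  HasFiniteLimits C ∧ HasCoproducts.{w} C ∧
    ∀ (I : Type w) (X : I → C) (c : Cofan X),
      Nonempty (IsColimit c) → CofanUniversal c ∧ CofanDisjoint c

/-- A parallel pair `r₁ r₂ : R ⟶ X` is an (internal) equivalence relation. -/
structure IsEquivalenceRelationPair {C : Type u₁} [Category.{v₁} C] {R X : C}
    (r₁ r₂ : R ⟶ X) : Prop where
  jointlyMono : ∀ {Z : C} (a b : Z ⟶ R), a ≫ r₁ = b ≫ r₁ → a ≫ r₂ = b ≫ r₂ → a = b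
  refl : ∀ {Z : C} (f : Z ⟶ X), ∃ d : Z ⟶ R, d ≫ r₁ = f ∧ d ≫ r₂ = f
  symm : ∃ s : R ⟶ R, s ≫ r₁ = r₂ ∧ s ≫ r₂ = r₁
  trans : ∀ {Z : C} (a b : Z ⟶ R), a ≫ r₂ = b ≫ r₁ →
    ∃ t : Z ⟶ R, t ≫ r₁ = a ≫ r₁ ∧ t ≫ r₂ = b ≫ r₂

/-- `C` is a regular category: finitely complete, with (regular epi, mono)
factorizations, and regular epimorphisms are stable under pullback. -/
def IsRegularCat (C : Type u₁) [Category.{v₁} C] : Prop :=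
  HasFiniteLimits C ∧
    (∀ {X Y : C} (f : X ⟶ Y), ∃ (Z : C) (e : X ⟶ Z) (m : Z ⟶ Y),
      e ≫ m = f ∧ Nonempty (RegularEpi e) ∧ Mono m) ∧
    (∀ {P X Y Z : C} (fst : P ⟶ X) (snd : P ⟶ Y) (f : X ⟶ Z) (g : Y ⟶ Z),
      IsPullback fst snd f g → Nonempty (RegularEpi g) → Nonempty (RegularEpi fst))

/-- `C` is an exact (Barr-exact) category: regular with effective equivalence relations. -/
def IsExactCat (C : Type u₁) [Category.{v₁} C] : Prop :=
  IsRegularCat C ∧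
    ∀ {R X : C} (r₁ r₂ : R ⟶ X), IsEquivalenceRelationPair r₁ r₂ →
      ∃ (Y : C) (f : X ⟶ Y), IsPullback r₁ r₂ f f

/-- A pretopos is an exact and extensive category. -/
def IsPretopos (C : Type u₁) [Category.{v₁} C] : Prop :=
  IsExactCat C ∧ IsExtensive C

/-- `C` is additive: preadditive with finite biproducts. -/
def IsAdditive (C : Type u₁) [Category.{v₁} C] : Prop :=
  ∃ p : Preadditive C, letI := p; HasFiniteBiproducts C

/-- `C` is wellpowered: every object has only a set of subobjects. -/
def Wellpowered (C : Type u₁) [Category.{v₁} C] : Prop :=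
  ∀ X : C, Small.{w} (Subobject X)

/-- `C` is cowellpowered: every object has only a set of quotient objects. -/
def Cowellpowered (C : Type u₁) [Category.{v₁} C] : Prop :=
  ∀ X : C, Small.{w} (Subobject (Opposite.op X))

/-- `C` has a clique-like class of objects, indexed by all ordinals. -/
def HasCliqueLikeClass (C : Type u₁) [Category.{v₁} C] : Prop :=
  ∃ (A : Ordinal.{v₁} → C) (R : MorphismProperty C),
    (∀ {X Y Z : C} (v : X ⟶ Y) (u : Y ⟶ Z), R (v ≫ u) → R u) ∧
    (∀ k, ∃ f g : A 0 ⟶ A k, f ≠ g ∧ R f ∧ R g) ∧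
    ((∀ i k : Ordinal.{v₁}, 0 < i → i < k → ∀ f : A k ⟶ A i, ¬ R f) ∨
     (∀ k i : Ordinal.{v₁}, 0 < k → k < i → ∀ f : A k ⟶ A i, ¬ R f))

/-- A presheaf is petty: a quotient of a small coproduct of representables. -/
def IsPetty {C : Type u₁} [Category.{v₁} C] (F : Cᵒᵖ ⥤ Type v₁) : Prop :=
  ∃ (I : Type v₁) (A : I → C) (e : (∐ fun i => yoneda.obj (A i)) ⟶ F), Epi e

/-- A presheaf is lucid: petty, and equalizers of pairs of morphisms from petty
presheaves into it are petty. -/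
noncomputable def IsLucid {C : Type u₁} [Category.{v₁} C] (F : Cᵒᵖ ⥤ Type v₁) : Prop :=
  IsPetty F ∧ ∀ (P : Cᵒᵖ ⥤ Type v₁), IsPetty P → ∀ u₁ u₂ : P ⟶ F, IsPetty (equalizer u₁ u₂)

universe v u

open Opposite

section Crit
variable {K : Type u} [Category.{v} K]

/-- Restriction of an element of a presheaf along a morphism. -/
def res (F : Kᵒᵖ ⥤ Type v) {X Y : K} (f : X ⟶ Y) (x : F.obj (op Y)) : F.obj (op X) :=
  F.map f.op x

theorem res_id (F : Kᵒᵖ ⥤ Type v) {X : K} (x : F.obj (op X)) : res F (𝟙 X) x = x := by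
  simp [res]

theorem res_comp (F : Kᵒᵖ ⥤ Type v) {X Y Z : K} (f : X ⟶ Y) (g : Y ⟶ Z) (x : F.obj (op Z)) :
    res F (f ≫ g) x = res F f (res F g x) := by
  simp [res]

theorem app_res {F G : Kᵒᵖ ⥤ Type v} (α : F ⟶ G) {X Y : K} (f : X ⟶ Y) (x : F.obj (op Y)) :
    α.app (op X) (res F f x) = res G f (α.app (op Y) x) :=
  NatTrans.naturality_apply α f.op x

theorem app_eq_res {D : K} {F : Kᵒᵖ ⥤ Type v} (α : yoneda.obj D ⟶ F) {X : K} (f : X ⟶ D) :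
    α.app (op X) f = res F f (α.app (op D) (𝟙 D)) := by
  have := app_res α f (𝟙 D)
  rw [← this]
  simp [res]

/-- Elementary form of smallness: generators and invariance. -/
def Elem (F : Kᵒᵖ ⥤ Type v) : Prop :=
  ∃ (T : Type v) (D : T → K),
    (∀ (X : K) (x : F.obj (op X)), ∃ (t : T) (p : X ⟶ D t) (y : F.obj (op (D t))),
      res F p y = x) ∧
    (∀ (X : K) (Q : ∀ t : T, (X ⟶ D t) → F.obj (op (D t)) → Prop),
      (∀ (t t' : T) (w : D t ⟶ D t') (p : X ⟶ D t) (y : F.obj (op (D t'))),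
        Q t p (res F w y) ↔ Q t' (p ≫ w) y) →
      ∀ (t t' : T) (p : X ⟶ D t) (p' : X ⟶ D t') (y : F.obj (op (D t)))
        (y' : F.obj (op (D t'))), res F p y = res F p' y' → Q t p y → Q t' p' y')

theorem isSmall_of_iso {F G : Kᵒᵖ ⥤ Type v} (e : F ≅ G) (h : IsSmallPresheaf.{v} F) :
    IsSmallPresheaf.{v} G := by
  obtain ⟨J, i, D, c, hc, ⟨e'⟩⟩ := h
  exact ⟨J, i, D, c, hc, ⟨e' ≪≫ e⟩⟩

theorem isSmall_yoneda (A : K) : IsSmallPresheaf.{v} (yoneda.obj A) := by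
  refine ⟨Discrete PUnit.{v+1}, inferInstance, (Functor.const _).obj A,
    { pt := yoneda.obj A, ι := { app := fun _ => 𝟙 _ } }, ⟨?_⟩, ⟨Iso.refl _⟩⟩
  exact
    { desc := fun s => s.ι.app ⟨PUnit.unit⟩
      fac := fun s j => by simp
      uniq := fun s m hm => by simpa using hm ⟨PUnit.unit⟩ }

/-- nice form of a small presheaf -/
theorem isSmall_cocone {F : Kᵒᵖ ⥤ Type v} (h : IsSmallPresheaf.{v} F) :
    ∃ (J : Type v) (_ : SmallCategory J) (D : J ⥤ K) (ι : D ⋙ yoneda ⟶ (Functor.const J).obj F),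
      Nonempty (IsColimit (Cocone.mk F ι)) := by
  obtain ⟨J, i, D, c, ⟨hc⟩, ⟨e⟩⟩ := h
  refine ⟨J, i, D, (c.extend e.hom).ι, ⟨IsColimit.ofIsoColimit hc ?_⟩⟩
  exact Cocone.ext e (fun j => rfl)

theorem colim_surj {J : Type v} [SmallCategory J] {Φ : J ⥤ (Kᵒᵖ ⥤ Type v)} {c : Cocone Φ}
    (hc : IsColimit c) {X : K} (x : c.pt.obj (op X)) :
    ∃ (j : J) (y : (Φ.obj j).obj (op X)), (c.ι.app j).app (op X) y = x := by
  have h := isColimitOfPreserves ((evaluation Kᵒᵖ (Type v)).obj (op X)) hc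
  obtain ⟨j, y, hy⟩ := Types.jointly_surjective _ h x
  exact ⟨j, y, hy⟩

/-- Descend an invariant of representatives to a colimit. -/
theorem colim_desc {J : Type v} [SmallCategory J] {Φ : J ⥤ (Kᵒᵖ ⥤ Type v)} {c : Cocone Φ}
    (hc : IsColimit c) {X : K} {S : Type v} (q : ∀ j, (Φ.obj j).obj (op X) → S)
    (hq : ∀ {j j' : J} (w : j ⟶ j') (y : (Φ.obj j).obj (op X)),
      q j' ((Φ.map w).app (op X) y) = q j y) :
    ∃ d : c.pt.obj (op X) → S, ∀ j y, d ((c.ι.app j).app (op X) y) = q j y := by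
  have h := isColimitOfPreserves ((evaluation Kᵒᵖ (Type v)).obj (op X)) hc
  let s : Cocone (Φ ⋙ (evaluation Kᵒᵖ (Type v)).obj (op X)) :=
    { pt := S
      ι := { app := fun j => TypeCat.ofHom (q j)
             naturality := fun j j' w => by
              ext y
              exact hq w y } }
  refine ⟨fun x => h.desc s x, fun j y => ?_⟩
  exact ConcreteCategory.congr_hom (h.fac s j) y

/-- generator form of a colimit of representables -/
theorem small_gen_of {J : Type v} [SmallCategory J] (D : J ⥤ K) {c : Cocone (D ⋙ yoneda)}
    (hc : IsColimit c) :
    ∃ (g : ∀ j, c.pt.obj (op (D.obj j))),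
      (∀ {j j' : J} (w : j ⟶ j'), res c.pt (D.map w) (g j') = g j) ∧
      (∀ (X : K) (x : c.pt.obj (op X)), ∃ (j : J) (p : X ⟶ D.obj j), res c.pt p (g j) = x) ∧
      (∀ (X : K) (S : Type v) (q : ∀ j, (X ⟶ D.obj j) → S),
        (∀ {j j' : J} (w : j ⟶ j') (p : X ⟶ D.obj j), q j' (p ≫ D.map w) = q j p) →
        ∃ d : c.pt.obj (op X) → S, ∀ j p, d (res c.pt p (g j)) = q j p) := by
  have ap : ∀ (j : J) {X : K} (p : X ⟶ D.obj j), (c.ι.app j).app (op X) p =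
      res c.pt p ((c.ι.app j).app (op (D.obj j)) (𝟙 (D.obj j))) := fun j X p =>
    app_eq_res (F := c.pt) (c.ι.app j) p
  refine ⟨fun j => (c.ι.app j).app (op (D.obj j)) (𝟙 (D.obj j)), ?_, ?_, ?_⟩
  · intro j j' w
    refine (ap j' (D.map w)).symm.trans ?_
    have := congrArg (fun α => α.app (op (D.obj j)) (𝟙 (D.obj j))) (c.ι.naturality w)
    simpa using this
  · intro X x
    obtain ⟨j, y, hy⟩ := colim_surj hc x
    exact ⟨j, y, (ap j y).symm.trans hy⟩
  · intro X S q hq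
    obtain ⟨d, hd⟩ := colim_desc hc (X := X) (S := S) (fun j (p : X ⟶ D.obj j) => q j p)
      (by intro j j' w y; exact hq w y)
    exact ⟨d, fun j p => (congrArg d (ap j p).symm).trans (hd j p)⟩

/-- generator form of a small presheaf -/
theorem small_gen {F : Kᵒᵖ ⥤ Type v} (h : IsSmallPresheaf.{v} F) :
    ∃ (J : Type v) (_ : SmallCategory J) (D : J ⥤ K) (g : ∀ j, F.obj (op (D.obj j))),
      (∀ {j j' : J} (w : j ⟶ j'), res F (D.map w) (g j') = g j) ∧
      (∀ (X : K) (x : F.obj (op X)), ∃ (j : J) (p : X ⟶ D.obj j), res F p (g j) = x) ∧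
      (∀ (X : K) (S : Type v) (q : ∀ j, (X ⟶ D.obj j) → S),
        (∀ {j j' : J} (w : j ⟶ j') (p : X ⟶ D.obj j), q j' (p ≫ D.map w) = q j p) →
        ∃ d : F.obj (op X) → S, ∀ j p, d (res F p (g j)) = q j p) := by
  obtain ⟨J, i, D, ι, ⟨hc⟩⟩ := isSmall_cocone h
  exact ⟨J, i, D, small_gen_of D hc⟩

theorem elem_of_isSmall {F : Kᵒᵖ ⥤ Type v} (h : IsSmallPresheaf.{v} F) : Elem F := by
  obtain ⟨J, i, D, g, key, surj, desc⟩ := small_gen h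
  refine ⟨J, D.obj, ?_, ?_⟩
  · intro X x
    obtain ⟨t, p, hp⟩ := surj X x
    exact ⟨t, p, _, hp⟩
  · intro X Q hQ
    obtain ⟨d, hd⟩ := desc X (ULift.{v} Prop) (fun j p => ⟨Q j p (g j)⟩) (by
        intro j j' w y
        congr 1
        rw [← key w]
        exact propext (hQ j j' (D.map w) y _).symm)
    have hd' : ∀ t (p : X ⟶ D.obj t) (y : F.obj (op (D.obj t))), Q t p y ↔ (d (res F p y)).down := by
      intro t p y
      obtain ⟨t', p', hp'⟩ := surj _ y
      rw [← hp', hQ, ← res_comp]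
      have := hd t' (p ≫ p')
      exact Iff.of_eq (congrArg ULift.down this).symm
    intro t t' p p' y y' he hq
    rw [hd'] at hq ⊢
    rwa [← he]

/-- index category for the criterion -/
structure Ix (F : Kᵒᵖ ⥤ Type v) {T : Type v} (D : T → K) : Type v where
  /-- index -/
  t : T
  /-- element -/
  y : F.obj (op (D t))

instance (F : Kᵒᵖ ⥤ Type v) {T : Type v} (D : T → K) : SmallCategory (Ix F D) where
  Hom a b := {w : D a.t ⟶ D b.t // res F w b.y = a.y}
  id a := ⟨𝟙 _, res_id _ _⟩
  comp f g := ⟨f.1 ≫ g.1, by rw [res_comp, g.2, f.2]⟩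
  id_comp f := Subtype.ext (Category.id_comp _)
  comp_id f := Subtype.ext (Category.comp_id _)
  assoc f g h := Subtype.ext (Category.assoc _ _ _)

/-- projection -/
def Ix.proj (F : Kᵒᵖ ⥤ Type v) {T : Type v} (D : T → K) : Ix F D ⥤ K where
  obj a := D a.t
  map f := f.1
  map_id _ := rfl
  map_comp _ _ := rfl

theorem isSmall_of_elem {F : Kᵒᵖ ⥤ Type v} (h : Elem F) : IsSmallPresheaf.{v} F := by
  obtain ⟨T, D, h1, h2⟩ := h
  choose tt pp yy hh using h1
  let c : Cocone (Ix.proj F D ⋙ yoneda) :=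
    { pt := F
      ι := { app := fun a => yonedaEquiv.symm a.y
             naturality := fun a b w => by
              ext X f
              change res F (f ≫ w.1) b.y = res F f a.y
              exact (res_comp F (Y := D a.t) f w.1 b.y).trans (congrArg (res F (Y := D a.t) f) w.2) } }
  have wd : ∀ (s : Cocone (Ix.proj F D ⋙ yoneda)) (X : K) (t t' : T) (p : X ⟶ D t) (p' : X ⟶ D t')
      (y : F.obj (op (D t))) (y' : F.obj (op (D t'))), res F p y = res F p' y' →
      (s.ι.app ⟨t', y'⟩).app (op X) p' = (s.ι.app ⟨t, y⟩).app (op X) p := by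
    intro s X t t' p p' y y' he
    refine h2 X (fun t' p' y' => (s.ι.app ⟨t', y'⟩).app (op X) p' =
      (s.ι.app ⟨t, y⟩).app (op X) p) ?_ t t' p p' y y' he rfl
    intro t₁ t₂ w q z
    let m : (⟨t₁, res F w z⟩ : Ix F D) ⟶ ⟨t₂, z⟩ := ⟨w, rfl⟩
    have := congrArg (fun α => α.app (op X) q) (s.w m)
    change (s.ι.app ⟨t₂, z⟩).app (op X) (q ≫ w) = _ at this
    exact ⟨fun h => this.trans h, fun h => this.symm.trans h⟩
  refine ⟨Ix F D, inferInstance, Ix.proj F D, c, ⟨?_⟩, ⟨Iso.refl _⟩⟩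
  exact
    { desc := fun s =>
        { app := fun X => TypeCat.ofHom fun x =>
            (s.ι.app ⟨tt X.unop x, yy X.unop x⟩).app X (pp X.unop x)
          naturality := fun X Y f => by
            ext x
            change (s.ι.app ⟨_, _⟩).app (op Y.unop) _ =
              s.pt.map f ((s.ι.app ⟨_, _⟩).app X (pp X.unop x))
            have e := NatTrans.naturality_apply (s.ι.app ⟨tt X.unop x, yy X.unop x⟩) f
              (pp X.unop x)
            refine Eq.trans ?_ e
            refine wd s Y.unop _ _ (f.unop ≫ pp X.unop x) _ _ _ ?_
            rw [hh, res_comp, hh]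
            rfl }
      fac := fun s a => by
        ext X f
        exact wd s X.unop _ _ f _ _ _ (hh _ _).symm
      uniq := fun s m hm => by
        ext X x
        have := congrArg (fun α => α.app X (pp X.unop x)) (hm ⟨tt X.unop x, yy X.unop x⟩)
        refine Eq.trans ?_ this
        change m.app X x = m.app X (res F (pp X.unop x) (yy X.unop x))
        rw [hh] }

end Crit

section PSsec
variable {K : Type u} [Category.{v} K]

/-- A class of morphisms into `A` generated by a small subfamily. -/
def PS {A : K} (S : ∀ X : K, (X ⟶ A) → Prop) : Prop :=
  ∃ (T : Type v) (Z : T → K) (e : ∀ t, Z t ⟶ A), (∀ t, S (Z t) (e t)) ∧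
    ∀ (X : K) (f : X ⟶ A), S X f → ∃ (t : T) (p : X ⟶ Z t), p ≫ e t = f

theorem PS.congr {A : K} {S S' : ∀ X : K, (X ⟶ A) → Prop} (h : PS S)
    (e : ∀ X f, S X f ↔ S' X f) : PS S' := by
  have : S = S' := by
    funext X f
    exact propext (e X f)
  rwa [← this]

theorem PS.bind {A : K} {S : ∀ X : K, (X ⟶ A) → Prop} {T : Type v} (Z : T → K)
    (e : ∀ t, Z t ⟶ A) (St : ∀ t (X : K), (X ⟶ Z t) → Prop) (h : ∀ t, PS (St t))
    (h1 : ∀ t X g, St t X g → S X (g ≫ e t))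
    (h2 : ∀ X f, S X f → ∃ t g, St t X g ∧ g ≫ e t = f) : PS S := by
  choose U Y d hd1 hd2 using h
  refine ⟨Σ t, U t, fun s => Y s.1 s.2, fun s => d s.1 s.2 ≫ e s.1, ?_, ?_⟩
  · intro s
    exact h1 _ _ _ (hd1 _ _)
  · intro X f hf
    obtain ⟨t, g, hg, rfl⟩ := h2 X f hf
    obtain ⟨r, p, rfl⟩ := hd2 t X g hg
    exact ⟨⟨t, r⟩, p, by simp⟩

theorem PS.iUnion {A : K} {I : Type v} {S : I → ∀ X : K, (X ⟶ A) → Prop}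
    (h : ∀ i, PS (S i)) : PS (fun X f => ∃ i, S i X f) := by
  refine PS.bind (fun _ : I => A) (fun _ => 𝟙 A) S h ?_ ?_
  · intro t X g hg
    exact ⟨t, by simpa using hg⟩
  · rintro X f ⟨i, hi⟩
    exact ⟨i, f, hi, by simp⟩

theorem PS.or {A : K} {S S' : ∀ X : K, (X ⟶ A) → Prop}
    (h : PS S) (h' : PS S') : PS (fun X f => S X f ∨ S' X f) := by
  refine (PS.iUnion (I := ULift.{v} Bool)
    (S := fun b X f => (b.down = true ∧ S X f) ∨ (b.down = false ∧ S' X f)) ?_).congr ?_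
  · rintro ⟨_ | _⟩
    · exact h'.congr (by simp)
    · exact h.congr (by simp)
  · intro X f
    constructor
    · rintro ⟨b, h | h⟩
      · exact Or.inl h.2
      · exact Or.inr h.2
    · rintro (h | h)
      · exact ⟨⟨true⟩, Or.inl ⟨rfl, h⟩⟩
      · exact ⟨⟨false⟩, Or.inr ⟨rfl, h⟩⟩

theorem PS.empty {A : K} : PS (fun (X : K) (_ : X ⟶ A) => False) :=
  ⟨PEmpty, PEmpty.elim, fun t => t.elim, fun t => t.elim, fun _ _ h => h.elim⟩

theorem PS.and_bind {A : K} {S S' : ∀ X : K, (X ⟶ A) → Prop}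
    (hs : ∀ X Y (f : X ⟶ Y) (g : Y ⟶ A), S Y g → S X (f ≫ g))
    (h : PS S) (h' : ∀ Y (e : Y ⟶ A), S Y e → PS (fun X f => S' X (f ≫ e))) :
    PS (fun X f => S X f ∧ S' X f) := by
  obtain ⟨T, Z, e, h1, h2⟩ := h
  refine PS.bind Z e (fun t X f => S' X (f ≫ e t)) (fun t => h' _ _ (h1 t)) ?_ ?_
  · intro t X g hg
    exact ⟨hs _ _ _ _ (h1 t), hg⟩
  · rintro X f ⟨hf, hf'⟩
    obtain ⟨t, p, rfl⟩ := h2 X f hf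
    exact ⟨t, p, hf', rfl⟩

/-- generated by a small set of elements -/
def Petty (P : Kᵒᵖ ⥤ Type v) : Prop :=
  ∃ (T : Type v) (D : T → K) (y : ∀ t, P.obj (op (D t))),
    ∀ (X : K) (x : P.obj (op X)), ∃ (t : T) (p : X ⟶ D t), res P p (y t) = x

/-- petty, with petty equalizers -/
def Lucid (P : Kᵒᵖ ⥤ Type v) : Prop :=
  Petty P ∧ ∀ (A : K) (x y : P.obj (op A)), PS (fun X (f : X ⟶ A) => res P f x = res P f y)

/-- pre-equalizers -/
def FP (K : Type u) [Category.{v} K] : Prop :=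
  ∀ (A B : K) (f g : A ⟶ B), PS (fun X (x : X ⟶ A) => x ≫ f = x ≫ g)

theorem Lucid.of_iso {P Q : Kᵒᵖ ⥤ Type v} (e : P ≅ Q) (h : Lucid P) : Lucid Q := by
  obtain ⟨⟨T, D, y, hy⟩, h2⟩ := h
  have e1 : ∀ {X : K} (x : Q.obj (op X)), e.hom.app (op X) (e.inv.app (op X) x) = x := by
    intro X x
    simp
  refine ⟨⟨T, D, fun t => e.hom.app _ (y t), fun X x => ?_⟩, fun A x y => ?_⟩
  · obtain ⟨t, p, hp⟩ := hy X (e.inv.app _ x)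
    refine ⟨t, p, ?_⟩
    rw [← app_res, hp, e1]
  · refine (h2 A (e.inv.app _ x) (e.inv.app _ y)).congr ?_
    intro X f
    rw [← app_res, ← app_res]
    constructor
    · intro h
      rw [← e1 (res Q f x), h, e1]
    · intro h
      rw [h]

theorem petty_of_isSmall {P : Kᵒᵖ ⥤ Type v} (h : IsSmallPresheaf.{v} P) : Petty P := by
  obtain ⟨J, i, D, g, -, h, -⟩ := small_gen h
  exact ⟨J, D.obj, g, h⟩

theorem lucid_yoneda (h : FP K) (C : K) : Lucid (yoneda.obj C) := by
  refine ⟨⟨PUnit, fun _ => C, fun _ => 𝟙 C, fun X x => ⟨PUnit.unit, x, ?_⟩⟩, fun A x y => ?_⟩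
  · change x ≫ 𝟙 C = x
    simp
  · exact h A C x y

section Zig
variable {J : Type v} [SmallCategory J] (Φ : J ⥤ (Kᵒᵖ ⥤ Type v))

/-- elements of the diagram -/
abbrev El (X : K) := Σ j, (Φ.obj j).obj (op X)

/-- restriction -/
def sres {X Y : K} (f : X ⟶ Y) (s : El Φ Y) : El Φ X := ⟨s.1, res _ f s.2⟩

/-- one step -/
def Stp {X : K} (s w : El Φ X) : Prop :=
  ∃ u : s.1 ⟶ w.1, (Φ.map u).app (op X) s.2 = w.2

/-- zigzags -/
def Zig {X : K} : ℕ → El Φ X → El Φ X → Prop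
  | 0, s, t => s = t
  | n+1, s, t => ∃ w, (Stp Φ s w ∨ Stp Φ w s) ∧ Zig n w t

theorem Zig.comp {X : K} (n m : ℕ) (s t r : El Φ X) (h : Zig Φ n s t) (h' : Zig Φ m t r) :
    Zig Φ (n + m) s r := by
  induction n generalizing s with
  | zero =>
    cases h
    simpa using h'
  | succ n ih =>
    obtain ⟨w, hw, h⟩ := h
    rw [Nat.add_right_comm]
    exact ⟨w, hw, ih _ h⟩

theorem sres_comp {X Y Z : K} (f : X ⟶ Y) (g : Y ⟶ Z) (s : El Φ Z) :
    sres Φ (f ≫ g) s = sres Φ f (sres Φ g s) := by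
  simp [sres, res_comp]

theorem ps_zig [HasFiniteProducts K] (hΦ : ∀ j, Lucid (Φ.obj j)) (n : ℕ) :
    ∀ (A : K) (s t : El Φ A), PS (fun X (f : X ⟶ A) => Zig Φ n (sres Φ f s) (sres Φ f t)) := by
  induction n with
  | zero =>
    rintro A ⟨j, ξ⟩ ⟨j', η⟩
    by_cases hj : j = j'
    · subst hj
      refine ((hΦ j).2 A ξ η).congr ?_
      intro X f
      simp [Zig, sres]
    · refine PS.empty.congr ?_
      intro X f
      simp only [false_iff]
      intro h
      exact hj (congrArg Sigma.fst h)
  | succ n ih =>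
    rintro A ⟨j, ξ⟩ t
    have h1 : PS (fun X (f : X ⟶ A) => ∃ i : (Σ k, (j ⟶ k)),
        Zig Φ n (sres Φ f ⟨i.1, (Φ.map i.2).app _ ξ⟩) (sres Φ f t)) :=
      PS.iUnion fun i => ih _ _ _
    have h2 : PS (fun X (f : X ⟶ A) => ∃ i : (Σ k, (k ⟶ j)),
        ∃ ζ : (Φ.obj i.1).obj (op X), (Φ.map i.2).app _ ζ = res _ f ξ ∧
        Zig Φ n ⟨i.1, ζ⟩ (sres Φ f t)) := by
      refine PS.iUnion fun i => ?_
      obtain ⟨k, u⟩ := i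
      obtain ⟨T, D, y, hy⟩ := (hΦ k).1
      refine PS.bind (T := T) (fun τ => A ⨯ D τ) (fun τ => prod.fst)
        (fun τ X h => res _ h (res _ prod.fst ξ) =
            res _ h (res _ prod.snd ((Φ.map u).app _ (y τ))) ∧
          Zig Φ n (sres Φ h (sres Φ prod.snd ⟨k, y τ⟩)) (sres Φ h (sres Φ prod.fst t))) ?_ ?_ ?_
      · intro τ
        refine PS.and_bind ?_ ((hΦ j).2 _ _ _) ?_
        · intro X Y f g hg
          rw [res_comp, hg, ← res_comp]
        · intro Y e _
          refine (ih Y (sres Φ e (sres Φ prod.snd ⟨k, y τ⟩))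
            (sres Φ e (sres Φ prod.fst t))).congr ?_
          intro X f
          rw [sres_comp, sres_comp Φ f e]
      · rintro τ X g ⟨hg1, hg2⟩
        refine ⟨res _ (g ≫ prod.snd) (y τ), ?_, ?_⟩
        · rw [app_res, res_comp, ← hg1, ← res_comp]
        · rw [← sres_comp, ← sres_comp] at hg2
          exact hg2
      · rintro X f ⟨ζ, h1, h2⟩
        obtain ⟨τ, p, hp⟩ := hy X ζ
        refine ⟨τ, prod.lift f p, ⟨?_, ?_⟩, prod.lift_fst _ _⟩
        · rw [← res_comp, ← res_comp, prod.lift_fst, prod.lift_snd, ← app_res, hp]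
          exact h1.symm
        · rw [← sres_comp, ← sres_comp, prod.lift_fst, prod.lift_snd]
          subst hp
          exact h2
    refine (h1.or h2).congr ?_
    intro X f
    constructor
    · rintro (⟨⟨k, u⟩, h⟩ | ⟨⟨k, u⟩, ζ, h, h'⟩)
      · exact ⟨sres Φ f ⟨k, (Φ.map u).app _ ξ⟩, Or.inl ⟨(u : j ⟶ k), app_res (Φ.map u) f ξ⟩, h⟩
      · exact ⟨⟨k, ζ⟩, Or.inr ⟨u, h⟩, h'⟩
    · rintro ⟨⟨k, ζ⟩, hst | ⟨u, h⟩, h'⟩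
      · left
        obtain ⟨u, h⟩ : ∃ u : j ⟶ k, (Φ.map u).app (op X) (res (Φ.obj j) f ξ) = ζ := hst
        refine ⟨⟨k, u⟩, ?_⟩
        rw [app_res] at h
        subst h
        exact h'
      · right
        exact ⟨⟨k, u⟩, ζ, h, h'⟩

theorem zig_of_eq {c : Cocone Φ} (hc : IsColimit c) {X : K} (s t : El Φ X)
    (h : (c.ι.app s.1).app (op X) s.2 = (c.ι.app t.1).app (op X) t.2) : ∃ n, Zig Φ n s t := by
  obtain ⟨d, hd⟩ := colim_desc hc (X := X) (S := ULift.{v} Prop)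
    (fun j y => ⟨∃ n, Zig Φ n ⟨j, y⟩ t⟩) (by
      intro j j' w y
      congr 1
      apply propext
      constructor
      · rintro ⟨n, h⟩
        exact ⟨n+1, _, Or.inl ⟨w, rfl⟩, h⟩
      · rintro ⟨n, h⟩
        exact ⟨n+1, _, Or.inr ⟨w, rfl⟩, h⟩)
  have h1 := congrArg d h
  rw [hd, hd] at h1
  have h2 : ∃ n, Zig Φ n ⟨t.1, t.2⟩ t := ⟨0, rfl⟩
  have h3 := congrArg ULift.down h1
  dsimp only at h3
  rw [← h3] at h2
  exact h2

theorem eq_of_zig (c : Cocone Φ) {X : K} (n : ℕ) (s t : El Φ X) (h : Zig Φ n s t) :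
    (c.ι.app s.1).app (op X) s.2 = (c.ι.app t.1).app (op X) t.2 := by
  have key : ∀ s w : El Φ X, Stp Φ s w →
      (c.ι.app s.1).app (op X) s.2 = (c.ι.app w.1).app (op X) w.2 := by
    rintro ⟨j, y⟩ ⟨k, z⟩ hst
    obtain ⟨u, hu⟩ : ∃ u : j ⟶ k, (Φ.map u).app (op X) y = z := hst
    have := congrArg (fun α => α.app (op X) y) (c.w u)
    rw [← hu]
    exact this.symm
  induction n generalizing s with
  | zero =>
    cases h
    rfl
  | succ n ih =>
    obtain ⟨w, hw, h⟩ := h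
    rw [← ih _ h]
    rcases hw with hw | hw
    · exact key _ _ hw
    · exact (key _ _ hw).symm

theorem lucid_colim [HasFiniteProducts K] (hΦ : ∀ j, Lucid (Φ.obj j)) {c : Cocone Φ}
    (hc : IsColimit c) : Lucid c.pt := by
  constructor
  · choose T D y hy using fun j => (hΦ j).1
    refine ⟨Σ j, T j, fun s => D s.1 s.2, fun s => (c.ι.app s.1).app _ (y s.1 s.2), ?_⟩
    intro X x
    obtain ⟨j, z, rfl⟩ := colim_surj hc x
    obtain ⟨t, p, rfl⟩ := hy j X z
    exact ⟨⟨j, t⟩, p, (app_res (c.ι.app j) p _).symm⟩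
  · intro A x y
    obtain ⟨j, ξ, rfl⟩ := colim_surj hc x
    obtain ⟨k, η, rfl⟩ := colim_surj hc y
    refine (PS.iUnion (I := ULift.{v} ℕ) fun n => ps_zig Φ hΦ n.down A ⟨j, ξ⟩ ⟨k, η⟩).congr ?_
    intro X f
    have e1 := app_res (c.ι.app j) f ξ
    have e2 := app_res (c.ι.app k) f η
    constructor
    · rintro ⟨n, h⟩
      exact e1.symm.trans ((eq_of_zig Φ c _ _ _ h).trans e2)
    · intro h
      obtain ⟨n, hn⟩ := zig_of_eq Φ hc ⟨j, res _ f ξ⟩ ⟨k, res _ f η⟩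
        (e1.trans (h.trans e2.symm))
      exact ⟨⟨n⟩, hn⟩

end Zig

theorem lucid_of_isSmall [HasFiniteProducts K] (h : FP K) {P : Kᵒᵖ ⥤ Type v}
    (hP : IsSmallPresheaf.{v} P) : Lucid P := by
  obtain ⟨J, i, D, c, ⟨hc⟩, ⟨e⟩⟩ := hP
  exact (lucid_colim (D ⋙ yoneda) (fun j => lucid_yoneda h _) hc).of_iso e

theorem isSmall_of_lucid [HasFiniteProducts K] {P : Kᵒᵖ ⥤ Type v} (h : Lucid P) :
    IsSmallPresheaf.{v} P := by
  apply isSmall_of_elem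
  obtain ⟨⟨T, D, g, hg⟩, h2⟩ := h
  choose U Z e he1 he2 using fun (s : T × T) => h2 (D s.1 ⨯ D s.2) (res P prod.fst (g s.1))
    (res P prod.snd (g s.2))
  refine ⟨T ⊕ (Σ s, U s), fun a => Sum.rec D (fun b => Z b.1 b.2) a, ?_, ?_⟩
  · intro X x
    obtain ⟨t, p, hp⟩ := hg X x
    exact ⟨Sum.inl t, p, g t, hp⟩
  · intro X Q hQ
    have main : ∀ (t t' : T) (p : X ⟶ D t) (p' : X ⟶ D t'), res P p (g t) = res P p' (g t') →
        Q (Sum.inl t) p (g t) → Q (Sum.inl t') p' (g t') := by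
      intro t t' p p' hpp hq
      obtain ⟨r, m, hm⟩ := he2 (t, t') X (prod.lift p p') (by
        dsimp only
        rw [← res_comp, ← res_comp, prod.lift_fst, prod.lift_snd, hpp])
      have a1 := hQ (Sum.inr ⟨(t, t'), r⟩) (Sum.inl t) (e (t, t') r ≫ prod.fst) m (g t)
      have a2 := hQ (Sum.inr ⟨(t, t'), r⟩) (Sum.inl t') (e (t, t') r ≫ prod.snd) m (g t')
      have b1 : m ≫ e (t, t') r ≫ prod.fst = p := by
        rw [← Category.assoc, hm, prod.lift_fst]
      have b2 : m ≫ e (t, t') r ≫ prod.snd = p' := by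
        rw [← Category.assoc, hm, prod.lift_snd]
      have b3 : res P (e (t, t') r ≫ prod.fst) (g t) = res P (e (t, t') r ≫ prod.snd) (g t') := by
        have := he1 (t, t') r
        dsimp only at this
        rwa [← res_comp, ← res_comp] at this
      have c1 : Q (Sum.inr ⟨(t, t'), r⟩) m (res P (e (t, t') r ≫ prod.fst) (g t)) := by
        apply a1.2
        exact b1.symm ▸ hq
      have c2 := a2.1 (b3 ▸ c1)
      exact b2 ▸ c2
    intro a a' p p' y y' he hq
    obtain ⟨t, w, rfl⟩ := hg _ y
    obtain ⟨t', w', rfl⟩ := hg _ y'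
    refine (hQ a' (Sum.inl t') w' p' (g t')).2 (main t t' (p ≫ w) (p' ≫ w') ?_
      ((hQ a (Sum.inl t) w p (g t)).1 hq))
    rw [res_comp, res_comp]
    exact he

end PSsec

section Pre
variable {K : Type u} [Category.{v} K]

theorem pre_wide (h : PreComplete K) {I : Type v} (B : K) (Z : I → K) (e : ∀ i, Z i ⟶ B) :
    ∃ (T : Type v) (W : T → K) (b : ∀ t, W t ⟶ B) (a : ∀ t i, W t ⟶ Z i),
      (∀ t i, a t i ≫ e i = b t) ∧
      ∀ (X : K) (f : X ⟶ B) (q : ∀ i, X ⟶ Z i), (∀ i, q i ≫ e i = f) →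
        ∃ (t : T) (p : X ⟶ W t), p ≫ b t = f ∧ ∀ i, p ≫ a t i = q i := by
  obtain ⟨T, c, hc⟩ := h (WidePullbackShape I) (WidePullbackShape.wideCospan B Z e)
  refine ⟨T, fun t => (c t).pt, fun t => (c t).π.app none, fun t i => (c t).π.app (some i), ?_, ?_⟩
  · intro t i
    exact (c t).w (WidePullbackShape.Hom.term i)
  · intro X f q hq
    obtain ⟨t, ⟨m⟩⟩ := hc (WidePullbackShape.mkCone (F := WidePullbackShape.wideCospan B Z e) f q hq)
    exact ⟨t, m.hom, m.w none, fun i => m.w (some i)⟩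

theorem PS.inter (h : PreComplete K) {A : K} {I : Type v} {S : I → ∀ X : K, (X ⟶ A) → Prop}
    (hs : ∀ i X Y (f : X ⟶ Y) (g : Y ⟶ A), S i Y g → S i X (f ≫ g))
    (hS : ∀ i, PS (S i)) : PS (fun X f => ∀ i, S i X f) := by
  choose T Z e he1 he2 using hS
  choose U W b a hb ha using fun c : (∀ i, T i) => pre_wide h A (fun i => Z i (c i))
    (fun i => e i (c i))
  refine ⟨Σ c, U c, fun s => W s.1 s.2, fun s => b s.1 s.2, ?_, ?_⟩
  · intro s i
    change S i (W s.1 s.2) (b s.1 s.2)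
    rw [← hb s.1 s.2 i]
    exact hs _ _ _ _ _ (he1 _ _)
  · intro X f hf
    choose c p hp using fun i => he2 i X f (hf i)
    obtain ⟨t, m, hm, -⟩ := ha c X f p hp
    exact ⟨⟨c, t⟩, m, hm⟩

variable [HasFiniteProducts K]

theorem fp_of_preComplete (h : PreComplete K) : FP K := by
  intro A B f g
  obtain ⟨T, W, b, a, hb, ha⟩ := pre_wide h (I := ULift.{v} Bool) (A ⨯ B) (fun _ => A)
    (fun i => if i.down then prod.lift (𝟙 A) f else prod.lift (𝟙 A) g)
  refine ⟨T, W, fun t => a t ⟨true⟩, ?_, ?_⟩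
  · intro t
    have h1 := hb t ⟨true⟩
    have h2 := (hb t ⟨false⟩).trans h1.symm
    simp only [Bool.false_eq_true, if_false, if_true, prod.comp_lift, Category.comp_id] at h2
    have h3 := congrArg (· ≫ prod.fst) h2
    have h4 := congrArg (· ≫ prod.snd) h2
    simp only [prod.lift_fst, prod.lift_snd] at h3 h4
    rw [h3] at h4
    exact h4.symm
  · intro X x hx
    obtain ⟨t, p, -, hp⟩ := ha X (prod.lift x (x ≫ f)) (fun _ => x) (by
      rintro ⟨_ | _⟩
      · simp [prod.comp_lift, hx]
      · simp [prod.comp_lift])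
    exact ⟨t, p, hp _⟩

theorem pre_prod (h : PreComplete K) {I : Type v} (Z : I → K) :
    ∃ (T : Type v) (W : T → K) (a : ∀ t i, W t ⟶ Z i),
      ∀ (X : K) (q : ∀ i, X ⟶ Z i), ∃ (t : T) (p : X ⟶ W t), ∀ i, p ≫ a t i = q i := by
  obtain ⟨T, W, b, a, hb, ha⟩ := pre_wide h (⊤_ K) Z (fun i => terminal.from _)
  refine ⟨T, W, a, fun X q => ?_⟩
  obtain ⟨t, p, -, hp⟩ := ha X (terminal.from _) q (fun i => Subsingleton.elim _ _)
  exact ⟨t, p, hp⟩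

/-- `G(A × -)` -/
noncomputable abbrev shift (A : K) (G : Kᵒᵖ ⥤ Type v) : Kᵒᵖ ⥤ Type v := (prod.functor.obj A).op ⋙ G

theorem res_shift (A : K) (G : Kᵒᵖ ⥤ Type v) {X Y : K} (f : X ⟶ Y) (x : G.obj (op (A ⨯ Y))) :
    res (shift A G) f x = res G (prod.map (𝟙 A) f) x := rfl

theorem lucid_shift (h : FP K) (hc : CartesianPreClosedOf.{v} K) (A : K) {G : Kᵒᵖ ⥤ Type v}
    (hG : IsSmallPresheaf.{v} G) : Lucid (shift A G) := by
  obtain ⟨J, i, D, c, ⟨hc'⟩, ⟨e⟩⟩ := hG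
  have h1 := isColimitOfPreserves
    ((Functor.whiskeringLeft Kᵒᵖ Kᵒᵖ (Type v)).obj (prod.functor.obj A).op) hc'
  have h2 := lucid_colim _ (fun j => lucid_of_isSmall h (hc A (D.obj j))) h1
  exact h2.of_iso (Functor.isoWhiskerLeft (prod.functor.obj A).op e)

/-- lucidity of `G(A × -)`, spelled out -/
def LucidAt (A : K) (G : Kᵒᵖ ⥤ Type v) : Prop :=
  (∃ (T : Type v) (D : T → K) (y : ∀ t, G.obj (op (A ⨯ D t))),
    ∀ (X : K) (x : G.obj (op (A ⨯ X))), ∃ (t : T) (p : X ⟶ D t),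
      res G (prod.map (𝟙 A) p) (y t) = x) ∧
  ∀ (B : K) (x y : G.obj (op (A ⨯ B))), PS (fun X (f : X ⟶ B) =>
    res G (prod.map (𝟙 A) f) x = res G (prod.map (𝟙 A) f) y)

theorem Lucid.at {A : K} {G : Kᵒᵖ ⥤ Type v} (h : Lucid (shift A G)) : LucidAt A G := h

theorem res_map_comp (A : K) (G : Kᵒᵖ ⥤ Type v) {X Y Z : K} (f : X ⟶ Y) (g : Y ⟶ Z)
    (x : G.obj (op (A ⨯ Z))) : res G (prod.map (𝟙 A) (f ≫ g)) x =
      res G (prod.map (𝟙 A) f) (res G (prod.map (𝟙 A) g) x) := by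
  rw [← res_comp]
  simp

/-- product of presheaves -/
def prodP (F G : Kᵒᵖ ⥤ Type v) : Kᵒᵖ ⥤ Type v where
  obj X := F.obj X × G.obj X
  map f := TypeCat.ofHom fun x => (F.map f x.1, G.map f x.2)

theorem lucid_prodP {F G : Kᵒᵖ ⥤ Type v} (hF : Lucid F) (hG : Lucid G) : Lucid (prodP F G) := by
  constructor
  · obtain ⟨T, D, y, hy⟩ := hF.1
    obtain ⟨T', D', y', hy'⟩ := hG.1
    refine ⟨T × T', fun s => D s.1 ⨯ D' s.2, fun s =>
      (res F prod.fst (y s.1), res G prod.snd (y' s.2)), ?_⟩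
    rintro X ⟨x, x'⟩
    obtain ⟨t, p, rfl⟩ := hy X x
    obtain ⟨t', p', rfl⟩ := hy' X x'
    refine ⟨(t, t'), prod.lift p p', ?_⟩
    change (res F (prod.lift p p') (res F prod.fst (y t)),
      res G (prod.lift p p') (res G prod.snd (y' t'))) = _
    rw [← res_comp, ← res_comp, prod.lift_fst, prod.lift_snd]
  · rintro A ⟨x, x'⟩ ⟨y, y'⟩
    refine (PS.and_bind (S := fun X f => res F f x = res F f y)
      (S' := fun X f => res G f x' = res G f y') ?_ (hF.2 A x y) ?_).congr ?_
    · intro X Y f g hg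
      rw [res_comp, hg, ← res_comp]
    · intro Y e _
      refine (hG.2 Y (res G e x') (res G e y')).congr ?_
      intro X f
      rw [res_comp, res_comp G f e]
    · intro X f
      exact (Prod.mk_inj (a₁ := res F f x) (b₁ := res G f x')).symm

/-- exponential presheaf -/
noncomputable def HP {J : Type v} [SmallCategory J] (D : J ⥤ K) (G : Kᵒᵖ ⥤ Type v) : Kᵒᵖ ⥤ Type v where
  obj X := {g : ∀ j, G.obj (op (D.obj j ⨯ X.unop)) //
    ∀ (j j' : J) (u : j ⟶ j'), res G (prod.map (D.map u) (𝟙 X.unop)) (g j') = g j}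
  map {X Y} f := TypeCat.ofHom fun g => ⟨fun j => res G (prod.map (𝟙 _) f.unop) (g.1 j), by
    intro j j' u
    change res G (prod.map (D.map u) (𝟙 _)) (res G (prod.map (𝟙 _) f.unop) (g.1 j')) =
      res G (prod.map (𝟙 _) f.unop) (g.1 j)
    rw [← g.2 j j' u, ← res_comp, ← res_comp]
    simp⟩
  map_id X := by
    ext g j
    change res G (prod.map (𝟙 _) (𝟙 _)) (g.1 j) = g.1 j
    rw [prod.map_id_id, res_id]
  map_comp {X Y Z} f f' := by
    ext g j
    change res G (prod.map (𝟙 _) (f'.unop ≫ f.unop)) (g.1 j) =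
      res G (prod.map (𝟙 _) f'.unop) (res G (prod.map (𝟙 _) f.unop) (g.1 j))
    rw [← res_comp]
    simp

theorem res_HP {J : Type v} [SmallCategory J] (D : J ⥤ K) (G : Kᵒᵖ ⥤ Type v) {X Y : K} (f : X ⟶ Y)
    (g : (HP D G).obj (op Y)) (j : J) :
    (res (HP D G) f g).1 j = res G (prod.map (𝟙 _) f) (g.1 j) := rfl

theorem HP_ext {J : Type v} [SmallCategory J] (D : J ⥤ K) (G : Kᵒᵖ ⥤ Type v) {X : K}
    (g g' : (HP D G).obj (op X)) (h : ∀ j, g.1 j = g'.1 j) : g = g' :=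
  Subtype.ext (funext h)

theorem lucid_HP (h : PreComplete K) {J : Type v} [SmallCategory J] (D : J ⥤ K)
    {G : Kᵒᵖ ⥤ Type v} (hG : ∀ A, LucidAt A G) : Lucid (HP D G) := by
  constructor
  · choose T E y hy using fun j => (hG (D.obj j)).1
    choose U W a ha using fun c : (∀ j, T j) => pre_prod h (fun j => E j (c j))
    have hps : ∀ (c : ∀ j, T j) (s : U c), PS (fun Z (f : Z ⟶ W c s) =>
        ∀ i : (Σ (j j' : J), (j ⟶ j')),
          res G (prod.map (𝟙 (D.obj i.1)) f) (res G (prod.map (D.map i.2.2) (a c s i.2.1))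
            (y i.2.1 (c i.2.1))) =
          res G (prod.map (𝟙 (D.obj i.1)) f) (res G (prod.map (𝟙 _) (a c s i.1)) (y i.1 (c i.1)))) := by
      intro c s
      refine PS.inter h ?_ ?_
      · intro i X Y f g hg
        rw [res_map_comp, hg, ← res_map_comp]
      · intro i
        exact (hG (D.obj i.1)).2 _ _ _
    choose V Z e he1 he2 using hps
    have he1' : ∀ c s r j j' (u : j ⟶ j'), res G (prod.map (D.map u) (𝟙 (Z c s r)))
        (res G (prod.map (𝟙 _) (e c s r ≫ a c s j')) (y j' (c j'))) =
        res G (prod.map (𝟙 _) (e c s r ≫ a c s j)) (y j (c j)) := by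
      intro c s r j j' u
      have := he1 c s r ⟨j, j', u⟩
      dsimp only at this
      rw [← res_comp, ← res_comp] at this
      rw [← res_comp]
      simpa using this
    refine ⟨Σ c s, V c s, fun i => Z i.1 i.2.1 i.2.2, fun i => ⟨fun j =>
      res G (prod.map (𝟙 _) (e i.1 i.2.1 i.2.2 ≫ a i.1 i.2.1 j)) (y j (i.1 j)),
      he1' i.1 i.2.1 i.2.2⟩, ?_⟩
    intro X x
    choose c p hp using fun j => hy j X (x.1 j)
    obtain ⟨s, m, hm⟩ := ha c X p
    obtain ⟨r, q, hq⟩ := he2 c s X m (by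
      rintro ⟨j, j', u⟩
      dsimp only
      have h1 := hp j
      have h2 := hp j'
      have h3 := x.2 j j' u
      rw [← h1, ← h2] at h3
      rw [← res_comp, ← res_comp]
      rw [← res_comp] at h3
      simpa [hm] using h3)
    refine ⟨⟨c, s, r⟩, q, HP_ext D G _ _ fun j => ?_⟩
    change res G (prod.map (𝟙 _) q) (res G (prod.map (𝟙 _) (e c s r ≫ a c s j)) (y j (c j))) = x.1 j
    rw [← hp j, ← res_comp]
    simp only [prod.map_map, Category.comp_id]
    rw [← Category.assoc, hq, hm]
  · intro A x y
    refine (PS.inter h (S := fun j X f => res G (prod.map (𝟙 (D.obj j)) f) (x.1 j) =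
      res G (prod.map (𝟙 (D.obj j)) f) (y.1 j)) ?_ (fun j => (hG (D.obj j)).2 _ _ _)).congr ?_
    · intro i X Y f g hg
      rw [res_map_comp, hg, ← res_map_comp]
    · intro X f
      constructor
      · intro h
        exact HP_ext D G _ _ h
      · intro h j
        exact congrFun (congrArg Subtype.val h) j

end Pre

section Tens
variable {K : Type u} [Category.{v} K]

/-- binatural operations -/
@[ext]
structure BiNat (F X G : Kᵒᵖ ⥤ Type v) where
  /-- the operation -/
  fn : ∀ Y : K, F.obj (op Y) → X.obj (op Y) → G.obj (op Y)
  nat : ∀ {Y Z : K} (f : Y ⟶ Z) (a : F.obj (op Z)) (x : X.obj (op Z)),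
    fn Y (res F f a) (res X f x) = res G f (fn Z a x)

/-- object of the completion represented by `A` -/
def yP (A : K) : PCompletion K := ⟨yoneda.obj A, isSmall_yoneda A⟩

/-- element as a morphism -/
def elt {F : PCompletion K} {Y : K} (a : F.obj.obj (op Y)) : yP Y ⟶ F :=
  ObjectProperty.homMk (yonedaEquiv.symm a)

/-- evaluate a morphism at the identity -/
def unelt {F : PCompletion K} {Y : K} (f : yP Y ⟶ F) : F.obj.obj (op Y) :=
  f.hom.app (op Y) (𝟙 Y)

/-- action of a morphism on elements -/
def act {F G : PCompletion K} (f : F ⟶ G) {Y : K} (a : F.obj.obj (op Y)) : G.obj.obj (op Y) :=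
  f.hom.app (op Y) a

theorem act_comp {F G H : PCompletion K} (f : F ⟶ G) (g : G ⟶ H) {Y : K}
    (a : F.obj.obj (op Y)) : act (f ≫ g) a = act g (act f a) := rfl

theorem act_res {F G : PCompletion K} (f : F ⟶ G) {Y Z : K} (m : Y ⟶ Z)
    (a : F.obj.obj (op Z)) : act f (res F.obj m a) = res G.obj m (act f a) :=
  app_res f.hom m a

theorem hom_ext_act {F G : PCompletion K} (f g : F ⟶ G)
    (h : ∀ (Y : K) (a : F.obj.obj (op Y)), act f a = act g a) : f = g := by
  ext Y a
  exact h Y.unop a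

theorem unelt_comp {F G : PCompletion K} {Y : K} (f : yP Y ⟶ F) (g : F ⟶ G) :
    unelt (f ≫ g) = act g (unelt f) := rfl

theorem unelt_elt {F : PCompletion K} {Y : K} (a : F.obj.obj (op Y)) : unelt (elt a) = a := by
  change F.obj.map (𝟙 _) a = a
  simp

theorem elt_act {F G : PCompletion K} {Y : K} (a : F.obj.obj (op Y)) (g : F ⟶ G) :
    elt (act g a) = elt a ≫ g := by
  apply hom_ext_act
  intro Z b
  rw [act_comp]
  exact (act_res g b a).symm

open MonoidalCategory CartesianMonoidalCategory

section
variable [CartesianMonoidalCategory (PCompletion K)]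

/-- pairing of elements -/
def pr {F X : PCompletion K} {Y : K} (a : F.obj.obj (op Y)) (x : X.obj.obj (op Y)) :
    (F ⊗ X).obj.obj (op Y) := unelt (lift (elt a) (elt x))

theorem fst_pr {F X : PCompletion K} {Y : K} (a : F.obj.obj (op Y)) (x : X.obj.obj (op Y)) :
    act (fst F X) (pr a x) = a := by
  rw [pr, ← unelt_comp, lift_fst, unelt_elt]

theorem snd_pr {F X : PCompletion K} {Y : K} (a : F.obj.obj (op Y)) (x : X.obj.obj (op Y)) :
    act (snd F X) (pr a x) = x := by
  rw [pr, ← unelt_comp, lift_snd, unelt_elt]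

theorem pr_ext {F X : PCompletion K} {Y : K} (z z' : (F ⊗ X).obj.obj (op Y))
    (h1 : act (fst F X) z = act (fst F X) z') (h2 : act (snd F X) z = act (snd F X) z') :
    z = z' := by
  have : elt z = elt z' := by
    apply CartesianMonoidalCategory.hom_ext
    · rw [← elt_act, ← elt_act, h1]
    · rw [← elt_act, ← elt_act, h2]
  rw [← unelt_elt z, this, unelt_elt]

theorem pr_eta {F X : PCompletion K} {Y : K} (z : (F ⊗ X).obj.obj (op Y)) :
    pr (act (fst F X) z) (act (snd F X) z) = z :=
  pr_ext _ _ (fst_pr _ _) (snd_pr _ _)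

theorem res_pr {F X : PCompletion K} {Y Z : K} (f : Y ⟶ Z) (a : F.obj.obj (op Z))
    (x : X.obj.obj (op Z)) : res (F ⊗ X).obj f (pr a x) = pr (res F.obj f a) (res X.obj f x) := by
  apply pr_ext
  · rw [act_res, fst_pr, fst_pr]
  · rw [act_res, snd_pr, snd_pr]

theorem whisker_pr {F X X' : PCompletion K} {Y : K} (f : X ⟶ X') (a : F.obj.obj (op Y))
    (x : X.obj.obj (op Y)) : act (F ◁ f) (pr a x) = pr a (act f x) := by
  apply pr_ext
  · rw [← act_comp, whiskerLeft_fst, fst_pr, fst_pr]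
  · rw [← act_comp, whiskerLeft_snd, act_comp, snd_pr, snd_pr]

/-- morphisms out of a product are binatural operations -/
def tensEquiv (F X G : PCompletion K) : (F ⊗ X ⟶ G) ≃ BiNat F.obj X.obj G.obj where
  toFun α := ⟨fun Y a x => act α (pr a x), fun f a x => by rw [← res_pr, act_res]⟩
  invFun θ := ObjectProperty.homMk
    { app := fun Y => TypeCat.ofHom fun z =>
        θ.fn Y.unop (act (fst F X) (Y := Y.unop) z) (act (snd F X) (Y := Y.unop) z)
      naturality := fun Y Z f => by
        ext z
        have := θ.nat f.unop (act (fst F X) (Y := Y.unop) z) (act (snd F X) (Y := Y.unop) z)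
        rw [← act_res, ← act_res] at this
        exact this }
  left_inv α := by
    apply hom_ext_act
    intro Y z
    change act α (pr (act (fst F X) z) (act (snd F X) z)) = _
    rw [pr_eta]
  right_inv θ := by
    ext Y a x
    change θ.fn Y (act (fst F X) (pr a x)) (act (snd F X) (pr a x)) = _
    rw [fst_pr, snd_pr]

theorem tensEquiv_whisker (F X X' G : PCompletion K) (f : X ⟶ X') (g : F ⊗ X' ⟶ G) {Y : K}
    (a : F.obj.obj (op Y)) (x : X.obj.obj (op Y)) :
    (tensEquiv F X G (F ◁ f ≫ g)).fn Y a x = (tensEquiv F X' G g).fn Y a (act f x) := by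
  change act (F ◁ f ≫ g) (pr a x) = act g (pr a (act f x))
  rw [act_comp, whisker_pr]

end

variable [HasFiniteProducts K]

/-- cartesian structure -/
noncomputable def cartP (h : FP K) : CartesianMonoidalCategory (PCompletion K) :=
  .ofChosenFiniteProducts
    ⟨asEmptyCone (yP (⊤_ K)), IsTerminal.ofUniqueHom
      (fun X => ObjectProperty.homMk
        { app := fun Y => TypeCat.ofHom fun _ => terminal.from Y.unop
          naturality := fun Y Z f => by
            ext z
            exact Subsingleton.elim (α := Z.unop ⟶ ⊤_ K) _ _ })
      (fun X m => by
        apply hom_ext_act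
        intro Y a
        exact Subsingleton.elim (α := Y ⟶ ⊤_ K) _ _)⟩
    (fun F G =>
      ⟨BinaryFan.mk (P := (⟨prodP F.obj G.obj, isSmall_of_lucid (lucid_prodP
          (lucid_of_isSmall h F.property) (lucid_of_isSmall h G.property))⟩ : PCompletion K))
        (ObjectProperty.homMk { app := fun Y => TypeCat.ofHom fun z => z.1 })
        (ObjectProperty.homMk { app := fun Y => TypeCat.ofHom fun z => z.2 }),
      BinaryFan.IsLimit.mk _
        (fun {T} f g => ObjectProperty.homMk
          { app := fun Y => TypeCat.ofHom fun z => (act f (Y := Y.unop) z, act g (Y := Y.unop) z)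
            naturality := fun Y Z m => by
              ext z
              exact Prod.ext (act_res f m.unop z) (act_res g m.unop z) })
        (fun f g => rfl) (fun f g => rfl)
        (fun {T} f g m hf hg => by
          apply hom_ext_act
          intro Y a
          exact Prod.ext (congrArg (fun α => act α a) hf) (congrArg (fun α => act α a) hg))⟩)

/-- universal property of the exponential presheaf -/
theorem hp_univ {F : Kᵒᵖ ⥤ Type v} {J : Type v} [SmallCategory J] (D : J ⥤ K)
    (g : ∀ j, F.obj (op (D.obj j)))
    (h1 : ∀ {j j' : J} (w : j ⟶ j'), res F (D.map w) (g j') = g j)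
    (h2 : ∀ (X : K) (x : F.obj (op X)), ∃ (j : J) (p : X ⟶ D.obj j), res F p (g j) = x)
    (h3 : ∀ (X : K) (S : Type v) (q : ∀ j, (X ⟶ D.obj j) → S),
        (∀ {j j' : J} (w : j ⟶ j') (p : X ⟶ D.obj j), q j' (p ≫ D.map w) = q j p) →
        ∃ d : F.obj (op X) → S, ∀ j p, d (res F p (g j)) = q j p)
    (G : Kᵒᵖ ⥤ Type v) (X : Kᵒᵖ ⥤ Type v) :
    ∃ e : BiNat F X G ≃ (X ⟶ HP D G), ∀ θ Y (x : X.obj (op Y)) j,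
      ((e θ).app (op Y) x).1 j =
        θ.fn (D.obj j ⨯ Y) (res F prod.fst (g j)) (res X prod.snd x) := by
  let fwd : BiNat F X G → (X ⟶ HP D G) := fun θ =>
    { app := fun Y => TypeCat.ofHom fun x => ⟨fun j =>
        θ.fn (D.obj j ⨯ Y.unop) (res F prod.fst (g j)) (res X prod.snd x), by
          intro j j' u
          rw [← θ.nat, ← res_comp, ← res_comp]
          simp only [prod.map_fst, prod.map_snd, Category.comp_id]
          rw [res_comp, h1]⟩
      naturality := fun Y Z f => by
        ext x
        refine HP_ext D G (X := Z.unop) _ _ fun j => ?_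
        change θ.fn (D.obj j ⨯ Z.unop) (res F prod.fst (g j)) (res X prod.snd (res X f.unop x)) =
          res G (prod.map (𝟙 _) f.unop)
            (θ.fn (D.obj j ⨯ Y.unop) (res F prod.fst (g j)) (res X prod.snd x))
        rw [← θ.nat, ← res_comp, ← res_comp, ← res_comp]
        simp }
  have key : ∀ θ Y (x : X.obj (op Y)) j, ((fwd θ).app (op Y) x).1 j =
        θ.fn (D.obj j ⨯ Y) (res F prod.fst (g j)) (res X prod.snd x) := fun _ _ _ _ => rfl
  refine ⟨Equiv.ofBijective fwd ⟨?_, ?_⟩, key⟩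
  · intro θ θ' hh
    ext Y a x
    obtain ⟨j, p, rfl⟩ := h2 Y a
    have hk : ∀ θ : BiNat F X G, θ.fn Y (res F p (g j)) x =
        res G (prod.lift p (𝟙 Y)) (((fwd θ).app (op Y) x).1 j) := by
      intro θ
      rw [key, ← θ.nat, ← res_comp, ← res_comp, prod.lift_fst, prod.lift_snd, res_id]
    rw [hk, hk, hh]
  · intro β
    have hex : ∀ (Y : K) (x : X.obj (op Y)), ∃ d : F.obj (op Y) → G.obj (op Y),
        ∀ j p, d (res F p (g j)) = res G (prod.lift p (𝟙 Y)) ((β.app (op Y) x).1 j) := by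
      intro Y x
      apply h3
      intro j j' w p
      have hb := (β.app (op Y) x).2 j j' w
      rw [← hb, ← res_comp]
      simp
    choose d hd using hex
    refine ⟨⟨fun Y a x => d Y x a, ?_⟩, ?_⟩
    · intro Y Z f a x
      obtain ⟨j, p, rfl⟩ := h2 Z a
      have hb : ((β.app (op Y) (res X f x)).1 j) =
          res G (prod.map (𝟙 _) f) ((β.app (op Z) x).1 j) := by
        rw [app_res, res_HP]
      rw [← res_comp, hd, hd, hb, ← res_comp, ← res_comp]
      simp
    · ext Y x
      induction Y with
      | op Y =>
      refine HP_ext D G _ _ fun j => ?_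
      change d (D.obj j ⨯ Y) (res X prod.snd x) (res F prod.fst (g j)) = (β.app (op Y) x).1 j
      have hb : ((β.app (op (D.obj j ⨯ Y)) (res X prod.snd x)).1 j) =
          res G (prod.map (𝟙 _) prod.snd) ((β.app (op Y) x).1 j) := by
        rw [app_res, res_HP]
      rw [hd, hb, ← res_comp]
      rw [prod.lift_map, Category.comp_id, Category.id_comp, prod.lift_fst_snd, res_id]

theorem closed_of_pre (h : PreComplete K) (hc : CartesianPreClosedOf.{v} K) :
    CartesianClosedP (PCompletion K) := by
  have hfp := fp_of_preComplete h
  refine ⟨cartP hfp, ?_⟩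
  let _ := cartP hfp
  have main : ∀ F G : PCompletion K, ∃ (H : PCompletion K) (e : ∀ X, (F ⊗ X ⟶ G) ≃ (X ⟶ H)),
      ∀ X X' (f : X ⟶ X') (g : F ⊗ X' ⟶ G), e X (F ◁ f ≫ g) = f ≫ e X' g := by
    intro F G
    obtain ⟨J, i, D, g, h1, h2, h3⟩ := small_gen F.property
    choose e he using hp_univ D g h1 h2 h3 G.obj
    have hH : IsSmallPresheaf.{v} (HP D G.obj) :=
      isSmall_of_lucid (lucid_HP h D fun A => (lucid_shift hfp hc A G.property).at)
    refine ⟨⟨HP D G.obj, hH⟩, fun X => ((tensEquiv F X G).trans (e X.obj)).trans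
      ⟨fun α => ObjectProperty.homMk α, fun α => α.hom, fun _ => rfl, fun _ => rfl⟩, ?_⟩
    intro X X' f α
    apply hom_ext_act
    intro Y x
    apply HP_ext
    intro j
    change ((e X.obj (tensEquiv F X G (F ◁ f ≫ α))).app (op Y) x).1 j =
      ((e X'.obj (tensEquiv F X' G α)).app (op Y) (act f x)).1 j
    rw [he, he, tensEquiv_whisker, act_res]
  choose H e he using main
  refine ⟨⟨fun F => ⟨_, Adjunction.adjunctionOfEquivRight (F := tensorLeft F)
    (fun X G => e F G X) ?_⟩⟩⟩
  intro X' X Y f g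
  exact he F Y X' X f g

end Tens

section Exp
variable {K : Type u} [Category.{v} K]
open MonoidalCategory CartesianMonoidalCategory

/-- isomorphism of presheaves from a natural bijection -/
theorem iso_of_equiv {F G : Kᵒᵖ ⥤ Type v} (e : ∀ X : K, F.obj (op X) ≃ G.obj (op X))
    (he : ∀ {X Y : K} (f : X ⟶ Y) (x : F.obj (op Y)), e X (res F f x) = res G f (e Y x)) :
    Nonempty (F ≅ G) :=
  ⟨NatIso.ofComponents (fun X => (e X.unop).toIso) (by
    intro X Y f
    ext x
    exact he f.unop x)⟩

theorem small_of_exp (h : CartesianClosedP (PCompletion K)) (F G : PCompletion K)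
    (E : Kᵒᵖ ⥤ Type v) (e : ∀ X : K, E.obj (op X) ≃ BiNat F.obj (yoneda.obj X) G.obj)
    (he : ∀ {X X' : K} (f : X ⟶ X') (z : E.obj (op X')) (Y : K) (a : F.obj.obj (op Y)) (x : Y ⟶ X),
      (e X (res E f z)).fn Y a x = (e X' z).fn Y a (x ≫ f)) : IsSmallPresheaf.{v} E := by
  obtain ⟨hc, ⟨hm⟩⟩ := h
  let H := (ihom F).obj G
  let φ0 : ∀ X : K, H.obj.obj (op X) ≃ (yP X ⟶ H) := fun X =>
    ⟨elt, unelt, unelt_elt, fun f => by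
      apply hom_ext_act
      intro Y a
      exact (act_res f (Y := Y) (Z := X) a (𝟙 X)).symm.trans (congrArg (act f) (Category.comp_id a))⟩
  let φ : ∀ X : K, H.obj.obj (op X) ≃ BiNat F.obj (yoneda.obj X) G.obj := fun X =>
    ((φ0 X).trans ((ihom.adjunction F).homEquiv (yP X) G).symm).trans (tensEquiv F (yP X) G)
  have hφ : ∀ {X X' : K} (f : X ⟶ X') (z : H.obj.obj (op X')) (Y : K)
      (a : F.obj.obj (op Y)) (x : Y ⟶ X),
      (φ X (res H.obj f z)).fn Y a x = (φ X' z).fn Y a (x ≫ f) := by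
    intro X X' f z Y a x
    let yf : yP X ⟶ yP X' := ObjectProperty.homMk (yoneda.map f)
    have e1 : elt (F := H) (res H.obj f z) = yf ≫ elt z := by
      apply hom_ext_act
      intro Y a
      exact (res_comp H.obj a f z).symm
    change (tensEquiv F (yP X) G (((ihom.adjunction F).homEquiv (yP X) G).symm
      (elt (F := H) (res H.obj f z)))).fn Y a x = _
    rw [e1, Adjunction.homEquiv_naturality_left_symm]
    exact tensEquiv_whisker F (yP X) (yP X') G yf _ a x
  obtain ⟨i⟩ := iso_of_equiv (F := H.obj) (G := E) (fun X => (φ X).trans (e X).symm) (by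
    intro X Y f z
    change (e X).symm (φ X (res H.obj f z)) = res E f ((e Y).symm (φ Y z))
    rw [Equiv.symm_apply_eq]
    ext Z a x
    rw [hφ, he, Equiv.apply_symm_apply])
  exact isSmall_of_iso i H.property

variable [HasFiniteProducts K]

theorem small_HP (h : CartesianClosedP (PCompletion K)) {J : Type v} [SmallCategory J] (D : J ⥤ K)
    {G : Kᵒᵖ ⥤ Type v} (hG : IsSmallPresheaf.{v} G) : IsSmallPresheaf.{v} (HP D G) := by
  let c := colimit.cocone (D ⋙ yoneda)
  have hc : IsColimit c := colimit.isColimit _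
  have hF : IsSmallPresheaf.{v} c.pt := ⟨J, inferInstance, D, c, ⟨hc⟩, ⟨Iso.refl _⟩⟩
  obtain ⟨g, h1, h2, h3⟩ := small_gen_of D hc
  choose e he using hp_univ D g h1 h2 h3 G
  refine small_of_exp h ⟨c.pt, hF⟩ ⟨G, hG⟩ _ (fun X => yonedaEquiv.symm.trans (e (yoneda.obj X)).symm) ?_
  intro X X' f z Y a x
  have key : ∀ (X : K) (z : (HP D G).obj (op X)) (Y : K) (x : Y ⟶ X) (j : J) (p : Y ⟶ D.obj j),
      ((e (yoneda.obj X)).symm (yonedaEquiv.symm z)).fn Y (res c.pt p (g j)) x =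
        res G (prod.lift p x) (z.1 j) := by
    intro X z Y x j p
    have h0 := he (yoneda.obj X) ((e (yoneda.obj X)).symm (yonedaEquiv.symm z)) Y x j
    rw [Equiv.apply_symm_apply] at h0
    have h4 : ((yonedaEquiv.symm z).app (op Y) x).1 j = res G (prod.map (𝟙 _) x) (z.1 j) := rfl
    rw [h4] at h0
    have h5 := ((e (yoneda.obj X)).symm (yonedaEquiv.symm z)).nat (prod.lift p (𝟙 Y))
      (res c.pt prod.fst (g j)) (res (yoneda.obj X) prod.snd x)
    rw [← h0, ← res_comp, ← res_comp, ← res_comp, prod.lift_fst, prod.lift_snd, res_id,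
      prod.lift_map, Category.comp_id, Category.id_comp] at h5
    exact h5
  obtain ⟨j, p, rfl⟩ := h2 Y a
  refine (key X _ Y x j p).trans ((?_ : _ = _).trans (key X' z Y (x ≫ f) j p).symm)
  rw [res_HP, ← res_comp]
  simp

theorem preClosed_of_closed (h : CartesianClosedP (PCompletion K)) : CartesianPreClosedOf.{v} K := by
  intro A B
  obtain ⟨i⟩ := iso_of_equiv (F := HP ((Functor.const (Discrete PUnit.{v+1})).obj A) (yoneda.obj B))
    (G := (prod.functor.obj A).op ⋙ yoneda.obj B)
    (fun X => ⟨fun g => g.1 ⟨PUnit.unit⟩, fun k => ⟨fun _ => k, fun j j' u => by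
      have h0 : ∀ k : A ⨯ X ⟶ B, prod.map (𝟙 A) (𝟙 X) ≫ k = k := by
        intro k
        rw [prod.map_id_id, Category.id_comp]
      exact h0 k⟩, fun g => rfl, fun k => rfl⟩)
    (fun f x => rfl)
  exact isSmall_of_iso i (small_HP h _ (isSmall_yoneda B))

/-- power of a presheaf -/
def POW (U : Type v) (G : Kᵒᵖ ⥤ Type v) : Kᵒᵖ ⥤ Type v where
  obj X := U → G.obj X
  map f := TypeCat.ofHom fun g u => G.map f (g u)

theorem small_POW (h : CartesianClosedP (PCompletion K)) (U : Type v)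
    {G : Kᵒᵖ ⥤ Type v} (hG : IsSmallPresheaf.{v} G) : IsSmallPresheaf.{v} (POW U G) := by
  have tl : ∀ X : K, prod.snd ≫ prod.lift (terminal.from X) (𝟙 X) = 𝟙 ((⊤_ K) ⨯ X) := by
    intro X
    apply Limits.prod.hom_ext
    · exact Subsingleton.elim _ _
    · exact (Category.assoc _ _ _).trans ((congrArg (prod.snd ≫ ·) (prod.lift_snd _ _)).trans
        ((Category.comp_id _).trans (Category.id_comp _).symm))
  obtain ⟨i⟩ := iso_of_equiv (F := HP ((Functor.const (Discrete U)).obj (⊤_ K)) G) (G := POW U G)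
    (fun X => ⟨fun g u => res G (prod.lift (terminal.from X) (𝟙 X)) (g.1 ⟨u⟩),
      fun k => ⟨fun j => res G prod.snd (k j.as), fun j j' u => by
        obtain rfl := Discrete.ext (Discrete.eq_of_hom u)
        change res G (prod.map (𝟙 (⊤_ K)) (𝟙 X)) _ = _
        rw [prod.map_id_id, res_id]⟩,
      fun g => by
        refine HP_ext _ _ _ _ fun j => ?_
        change res G prod.snd (res G (prod.lift (terminal.from X) (𝟙 X)) (g.1 j)) = g.1 j
        exact (res_comp G _ _ _).symm.trans ((congrArg (fun w => res G w (g.1 j)) (tl X)).trans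
          (res_id G _)),
      fun k => by
        funext u
        change res G (prod.lift (terminal.from X) (𝟙 X)) (res G prod.snd (k u)) = k u
        rw [← res_comp, prod.lift_snd, res_id]⟩)
    (fun {X Y} f x => by
      funext u
      change res G (prod.lift (terminal.from X) (𝟙 X)) (res G (prod.map (𝟙 _) f) (x.1 ⟨u⟩)) =
        res G f (res G (prod.lift (terminal.from Y) (𝟙 Y)) (x.1 ⟨u⟩))
      rw [← res_comp, ← res_comp]
      congr 1
      apply Limits.prod.hom_ext
      · exact Subsingleton.elim _ _
      · simp)
  exact isSmall_of_iso i (small_HP h _ hG)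

/-- elements of `G(T × X)` coequalized by `r`, `s` -/
noncomputable def EQ {R T : K} (r s : R ⟶ T) (G : Kᵒᵖ ⥤ Type v) : Kᵒᵖ ⥤ Type v where
  obj X := {g : G.obj (op (T ⨯ X.unop)) //
    res G (prod.map r (𝟙 X.unop)) g = res G (prod.map s (𝟙 X.unop)) g}
  map {X Y} f := TypeCat.ofHom fun g => ⟨res G (prod.map (𝟙 _) f.unop) g.1, by
    have h1 : ∀ t : R ⟶ T, prod.map t (𝟙 Y.unop) ≫ prod.map (𝟙 T) f.unop =
        prod.map (𝟙 R) f.unop ≫ prod.map t (𝟙 X.unop) := by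
      intro t
      simp
    rw [← res_comp, ← res_comp, h1, h1, res_comp, res_comp, g.2]⟩
  map_id X := by
    ext g
    change res G (prod.map (𝟙 _) (𝟙 _)) g.1 = g.1
    rw [prod.map_id_id, res_id]
  map_comp {X Y Z} f f' := by
    ext g
    change res G (prod.map (𝟙 _) (f'.unop ≫ f.unop)) g.1 =
      res G (prod.map (𝟙 _) f'.unop) (res G (prod.map (𝟙 _) f.unop) g.1)
    rw [← res_comp]
    simp

/-- objects of a small parallel pair -/
inductive PV : Type v
  | z
  | o

/-- morphisms of a small parallel pair -/
inductive PVHom : PV.{v} → PV.{v} → Type v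
  | id (X : PV.{v}) : PVHom X X
  | l : PVHom PV.z PV.o
  | m : PVHom PV.z PV.o

/-- composition -/
def PVHom.comp : ∀ {X Y Z : PV.{v}}, PVHom X Y → PVHom Y Z → PVHom X Z
  | _, _, _, PVHom.id _, h => h
  | _, _, _, PVHom.l, PVHom.id _ => PVHom.l
  | _, _, _, PVHom.m, PVHom.id _ => PVHom.m

instance : SmallCategory PV.{v} where
  Hom := PVHom
  id := PVHom.id
  comp := PVHom.comp
  id_comp f := by cases f <;> rfl
  comp_id f := by cases f <;> rfl
  assoc f g h := by cases f <;> cases g <;> cases h <;> rfl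

/-- objects of the diagram -/
abbrev ppvo (R T : K) : PV.{v} → K
  | PV.z => R
  | PV.o => T

/-- morphisms of the diagram -/
abbrev ppvm {R T : K} (r s : R ⟶ T) : ∀ {X Y : PV.{v}}, PVHom X Y → (ppvo R T X ⟶ ppvo R T Y)
  | _, _, PVHom.id _ => 𝟙 _
  | _, _, PVHom.l => r
  | _, _, PVHom.m => s

/-- small parallel pair diagram -/
abbrev ppv {R T : K} (r s : R ⟶ T) : PV.{v} ⥤ K where
  obj := ppvo R T
  map f := ppvm r s f
  map_id X := rfl
  map_comp {X Y Z} f g := by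
    change PVHom X Y at f
    change PVHom Y Z at g
    cases f with
    | id => exact (Category.id_comp _).symm
    | l => cases g; exact (Category.comp_id _).symm
    | m => cases g; exact (Category.comp_id _).symm

theorem small_EQ (h : CartesianClosedP (PCompletion K)) {R T : K} (r s : R ⟶ T)
    {G : Kᵒᵖ ⥤ Type v} (hG : IsSmallPresheaf.{v} G) : IsSmallPresheaf.{v} (EQ r s G) := by
  obtain ⟨i⟩ := iso_of_equiv (F := HP (ppv r s) G) (G := EQ r s G)
    (fun X => ⟨fun g => ⟨g.1 PV.o, (g.2 PV.z PV.o PVHom.l).trans (g.2 PV.z PV.o PVHom.m).symm⟩,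
      fun k => ⟨fun j => PV.rec
        (motive := fun t => G.obj (op (ppvo R T t ⨯ X)))
        (res G (prod.map r (𝟙 X)) k.1) k.1 j, by
          intro j j' u
          change PVHom j j' at u
          cases u with
          | id =>
            change res G (prod.map (𝟙 _) (𝟙 X)) _ = _
            rw [prod.map_id_id, res_id]
          | l => rfl
          | m => exact k.2.symm⟩,
      fun g => by
        refine HP_ext _ _ _ _ ?_
        intro j
        cases j with
        | z => exact g.2 PV.z PV.o PVHom.l
        | o => rfl,
      fun k => rfl⟩)
    (fun {X Y} f x => rfl)
  exact isSmall_of_iso i (small_HP h _ hG)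
end Exp

section CqSec
variable {K : Type u} [Category.{v} K]

/-- the generating relation -/
def CqRel {R T : K} (r s : R ⟶ T) (X : K) (a b : X ⟶ T) : Prop :=
  ∃ c : X ⟶ R, a = c ≫ r ∧ b = c ≫ s

/-- coequalizer of representables -/
def Cq {R T : K} (r s : R ⟶ T) : Kᵒᵖ ⥤ Type v where
  obj X := Quot (CqRel r s X.unop)
  map f := TypeCat.ofHom (Quot.map (fun b => f.unop ≫ b) (by
    rintro a b ⟨c, rfl, rfl⟩
    exact ⟨f.unop ≫ c, by simp, by simp⟩))
  map_id X := by
    ext q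
    obtain ⟨b, rfl⟩ := Quot.exists_rep q
    exact congrArg (Quot.mk _) (Category.id_comp b)
  map_comp {X Y Z} f g := by
    ext q
    obtain ⟨b, rfl⟩ := Quot.exists_rep q
    exact congrArg (Quot.mk _) (Category.assoc g.unop f.unop b)

/-- class of a morphism -/
def cmk {R T : K} (r s : R ⟶ T) {X : K} (b : X ⟶ T) : (Cq r s).obj (op X) := Quot.mk _ b

theorem res_cmk {R T : K} (r s : R ⟶ T) {X Y : K} (f : X ⟶ Y) (b : Y ⟶ T) :
    res (Cq r s) f (cmk r s b) = cmk r s (f ≫ b) := rfl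

theorem cmk_surj {R T : K} (r s : R ⟶ T) {X : K} (q : (Cq r s).obj (op X)) :
    ∃ b : X ⟶ T, cmk r s b = q := Quot.exists_rep q

theorem cmk_sound {R T : K} (r s : R ⟶ T) {X : K} (c : X ⟶ R) :
    cmk r s (c ≫ r) = cmk r s (c ≫ s) := Quot.sound ⟨c, rfl, rfl⟩

/-- generating objects -/
abbrev cqD (R T : K) : ULift.{v} Bool → K := fun t => if t.down then T else R

theorem small_Cq {R T : K} (r s : R ⟶ T) : IsSmallPresheaf.{v} (Cq r s) := by
  have key : ∀ (I : Type v) (D : I → K) (i j : I) (_ : D i = T) (_ : D j = R), 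
      Elem (Cq r s) := by
    intro I D i j hi hj
    subst hi
    subst hj
    refine ⟨I, D, ?_, ?_⟩
    · intro X x
      obtain ⟨b, rfl⟩ := cmk_surj r s x
      refine ⟨i, b, cmk r s (𝟙 _), ?_⟩
      rw [res_cmk, Category.comp_id]
    · intro X Q hQ
      have h1 : ∀ (t : I) (p : X ⟶ D t) (b : D t ⟶ D i),
          Q t p (cmk r s b) ↔ Q i (p ≫ b) (cmk r s (𝟙 _)) := by
        intro t p b
        have := hQ t i b p (cmk r s (𝟙 _))
        rwa [res_cmk, Category.comp_id] at this
      have h2 : ∀ a b : X ⟶ D i, CqRel r s X a b →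
          Q i a (cmk r s (𝟙 _)) = Q i b (cmk r s (𝟙 _)) := by
        rintro a b ⟨c, rfl, rfl⟩
        have e : cmk r s r = cmk r s s := by
          have := cmk_sound r s (𝟙 _)
          rwa [Category.id_comp, Category.id_comp] at this
        rw [← h1, ← h1, e]
      intro t t' p p' y y' he hq
      obtain ⟨b, rfl⟩ := cmk_surj r s y
      obtain ⟨b', rfl⟩ := cmk_surj r s y'
      rw [res_cmk, res_cmk] at he
      rw [h1] at hq ⊢
      have := congrArg (Quot.lift (fun a => Q i a (cmk r s (𝟙 _))) h2) he
      exact this.mp hq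
  exact isSmall_of_elem (key (ULift.{v} Bool) (cqD R T) ⟨true⟩ ⟨false⟩ rfl rfl)

theorem cmk_eq {R T : K} (r s : R ⟶ T) {X : K}
    (h1 : ∀ c c' : X ⟶ R, c ≫ s = c' ≫ s → c = c')
    (h2 : ∀ c c' : X ⟶ R, c ≫ r = c' ≫ r → c = c')
    (h3 : ∀ c c' : X ⟶ R, c ≫ s = c' ≫ r → c ≫ r = c' ≫ s) (p q : X ⟶ T)
    (h : cmk r s p = cmk r s q) :
    p = q ∨ ∃ c : X ⟶ R, (p = c ≫ r ∧ q = c ≫ s) ∨ (p = c ≫ s ∧ q = c ≫ r) := by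
  have h' : Relation.EqvGen (CqRel r s X) p q := Quot.eqvGen_exact h
  induction h' with
  | rel a b hab =>
    obtain ⟨c, hc⟩ := hab
    exact Or.inr ⟨c, Or.inl hc⟩
  | refl a => exact Or.inl rfl
  | symm a b hab ih =>
    rcases ih h.symm with rfl | ⟨c, hc | hc⟩
    · exact Or.inl rfl
    · exact Or.inr ⟨c, Or.inr ⟨hc.2, hc.1⟩⟩
    · exact Or.inr ⟨c, Or.inl ⟨hc.2, hc.1⟩⟩
  | trans a b d hab hbd ih ih' =>
    rcases ih (Quot.eqvGen_sound hab) with rfl | ⟨c, hc⟩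
    · exact ih' h
    · rcases ih' (Quot.eqvGen_sound hbd) with rfl | ⟨c', hc'⟩
      · exact Or.inr ⟨c, hc⟩
      · left
        rcases hc with ⟨hc1, hc2⟩ | ⟨hc1, hc2⟩ <;> rcases hc' with ⟨hc1', hc2'⟩ | ⟨hc1', hc2'⟩
        · rw [hc1, hc2', h3 c c' (hc2.symm.trans hc1')]
        · rw [hc1, hc2', h1 c c' (hc2.symm.trans hc1')]
        · rw [hc1, hc2', h2 c c' (hc2.symm.trans hc1')]
        · rw [hc1, hc2', h3 c' c (hc1'.symm.trans hc2)]
end CqSec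

section CaseI
variable {K : Type u} [Category.{v} K] [HasFiniteProducts K]

theorem res_EQ {R T : K} (r s : R ⟶ T) (G : Kᵒᵖ ⥤ Type v) {X Y : K} (f : X ⟶ Y)
    (g : (EQ r s G).obj (op Y)) : (res (EQ r s G) f g).1 = res G (prod.map (𝟙 _) f) g.1 := rfl

theorem caseI (h : CartesianClosedP (PCompletion K)) {A B : K} (f g : A ⟶ B) :
    ∃ (I : Type v) (Z : I → K) (e : ∀ t, Z t ⟶ A), (∀ t, e t ≫ f = e t ≫ g) ∧
      ∀ (X : K) (x : X ⟶ A), x ≫ f = x ≫ g →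
        (prod.fst ≫ prod.fst : ((A ⨯ B) ⨯ (A ⨯ B)) ⨯ X ⟶ A ⨯ B) ≠ prod.fst ≫ prod.snd →
        ∃ (t : I) (p : X ⟶ Z t), p ≫ e t = x := by
  generalize hΦ : (A ⨯ B) = Φ
  let σ : Φ ⨯ Φ ⟶ Φ ⨯ Φ := prod.lift prod.snd prod.fst
  have hσ : σ ≫ σ = 𝟙 _ := by
    apply Limits.prod.hom_ext <;> simp [σ, prod.lift_fst, prod.lift_snd, prod.lift_fst_assoc, prod.lift_snd_assoc]
  have hσ1 : ∀ {Y : K} (u : Y ⟶ Φ ⨯ Φ), (u ≫ σ) ≫ σ = u := by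
    intro Y u
    rw [Category.assoc, hσ, Category.comp_id]
  have hσ2 : σ ≫ prod.fst = prod.snd := prod.lift_fst _ _
  clear_value σ
  let r : A ⨯ (Φ ⨯ Φ) ⟶ A ⨯ (B ⨯ (Φ ⨯ Φ)) := prod.lift prod.fst (prod.lift (prod.fst ≫ f) prod.snd)
  let s : A ⨯ (Φ ⨯ Φ) ⟶ A ⨯ (B ⨯ (Φ ⨯ Φ)) :=
    prod.lift prod.fst (prod.lift (prod.fst ≫ g) (prod.snd ≫ σ))
  -- components
  let cA : A ⨯ (B ⨯ (Φ ⨯ Φ)) ⟶ A := prod.fst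
  let cB : A ⨯ (B ⨯ (Φ ⨯ Φ)) ⟶ B := prod.snd ≫ prod.fst
  let cT : A ⨯ (B ⨯ (Φ ⨯ Φ)) ⟶ Φ ⨯ Φ := prod.snd ≫ prod.snd
  have ext1 : ∀ {Y : K} (u w : Y ⟶ A ⨯ (B ⨯ (Φ ⨯ Φ))), u ≫ cA = w ≫ cA → u ≫ cB = w ≫ cB →
      u ≫ cT = w ≫ cT → u = w := by
    intro Y u w h1 h2 h3
    apply Limits.prod.hom_ext
    · exact h1
    · apply Limits.prod.hom_ext
      · simpa [cB] using h2
      · simpa [cT] using h3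
  have rA : r ≫ cA = prod.fst := by simp [r, cA, prod.lift_fst, prod.lift_snd, prod.lift_fst_assoc, prod.lift_snd_assoc]
  have rB : r ≫ cB = prod.fst ≫ f := by simp [r, cB, prod.lift_fst, prod.lift_snd, prod.lift_fst_assoc, prod.lift_snd_assoc]
  have rT : r ≫ cT = prod.snd := by simp [r, cT, prod.lift_fst, prod.lift_snd, prod.lift_fst_assoc, prod.lift_snd_assoc]
  have sA : s ≫ cA = prod.fst := by simp [s, cA, prod.lift_fst, prod.lift_snd, prod.lift_fst_assoc, prod.lift_snd_assoc]
  have sB : s ≫ cB = prod.fst ≫ g := by simp [s, cB, prod.lift_fst, prod.lift_snd, prod.lift_fst_assoc, prod.lift_snd_assoc]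
  have sT : s ≫ cT = prod.snd ≫ σ := by simp [s, cT, prod.lift_fst, prod.lift_snd, prod.lift_fst_assoc, prod.lift_snd_assoc]
  let kx : ∀ {X : K} (x : X ⟶ A), (Φ ⨯ Φ) ⨯ X ⟶ A ⨯ (B ⨯ (Φ ⨯ Φ)) := fun x =>
    prod.lift (prod.snd ≫ x) (prod.lift (prod.snd ≫ x ≫ f) prod.fst)
  have kA : ∀ {X : K} (x : X ⟶ A), kx x ≫ cA = prod.snd ≫ x := by
    intro X x
    simp [kx, cA, prod.lift_fst, prod.lift_snd, prod.lift_fst_assoc, prod.lift_snd_assoc]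
  have kB : ∀ {X : K} (x : X ⟶ A), kx x ≫ cB = prod.snd ≫ x ≫ f := by
    intro X x
    simp [kx, cB, prod.lift_fst, prod.lift_snd, prod.lift_fst_assoc, prod.lift_snd_assoc]
  have kT : ∀ {X : K} (x : X ⟶ A), kx x ≫ cT = prod.fst := by
    intro X x
    simp [kx, cT, prod.lift_fst, prod.lift_snd, prod.lift_fst_assoc, prod.lift_snd_assoc]
  clear_value r s cA cB cT kx
  have eqv : ∀ {Y : K} (p q : Y ⟶ A ⨯ (B ⨯ (Φ ⨯ Φ))), cmk r s p = cmk r s q →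
      p = q ∨ ∃ c : Y ⟶ A ⨯ (Φ ⨯ Φ), (p = c ≫ r ∧ q = c ≫ s) ∨ (p = c ≫ s ∧ q = c ≫ r) := by
    intro Y p q
    refine cmk_eq r s ?_ ?_ ?_ p q
    · intro c c' hc
      apply Limits.prod.hom_ext
      · rw [← sA, ← Category.assoc, hc, Category.assoc]
      · rw [← hσ1 (c ≫ prod.snd), ← hσ1 (c' ≫ prod.snd), Category.assoc c, Category.assoc c', ← sT,
          ← Category.assoc, hc, Category.assoc c']
    · intro c c' hc
      apply Limits.prod.hom_ext
      · rw [← rA, ← Category.assoc, hc, Category.assoc]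
      · rw [← rT, ← Category.assoc, hc, Category.assoc]
    · intro c c' hc
      have e1 : c ≫ prod.fst = c' ≫ prod.fst := by
        rw [← sA, ← Category.assoc, hc, Category.assoc, rA, sA]
      have e2 : c ≫ prod.fst ≫ g = c' ≫ prod.fst ≫ f := by
        rw [← sB, ← Category.assoc, hc, Category.assoc, rB]
      have e3 : (c ≫ prod.snd) ≫ σ = c' ≫ prod.snd := by
        rw [Category.assoc, ← sT, ← Category.assoc, hc, Category.assoc, rT]
      apply ext1
      · rw [Category.assoc, Category.assoc, rA, sA, e1]
      · rw [Category.assoc, Category.assoc, rB, sB, ← Category.assoc, e1, Category.assoc, ← e2,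
          ← Category.assoc, e1, Category.assoc]
      · rw [Category.assoc, Category.assoc, rT, sT, ← Category.assoc, ← e3, hσ1]
  obtain ⟨I, D, y, hy⟩ := petty_of_isSmall (small_EQ h (𝟙 (Φ ⨯ Φ)) σ (small_Cq r s))
  choose k hk using fun t => cmk_surj r s (y t).1
  have hkt : ∀ t, prod.map σ (𝟙 _) ≫ k t = k t ∨ (k t ≫ cA) ≫ f = (k t ≫ cA) ≫ g := by
    intro t
    have e : cmk r s (k t) = cmk r s (prod.map σ (𝟙 _) ≫ k t) := by
      have := (y t).2
      rw [← hk t] at this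
      have e2 : res (Cq r s) (prod.map (𝟙 (Φ ⨯ Φ)) (𝟙 (D t))) (cmk r s (k t)) = cmk r s (k t) := by
        rw [prod.map_id_id, res_id]
      exact e2.symm.trans this
    rcases eqv _ _ e with h1 | ⟨c, ⟨h1, h2⟩ | ⟨h1, h2⟩⟩
    · exact Or.inl h1.symm
    · right
      have a1 : k t ≫ cA = c ≫ prod.fst := by rw [h1, Category.assoc, rA]
      have a2 : prod.map σ (𝟙 _) ≫ k t ≫ cA = c ≫ prod.fst := by
        rw [← Category.assoc, h2, Category.assoc, sA]
      have b1 : k t ≫ cB = (k t ≫ cA) ≫ f := by rw [a1, h1, Category.assoc, rB, Category.assoc]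
      have b2 : prod.map σ (𝟙 _) ≫ k t ≫ cB = c ≫ prod.fst ≫ g := by
        rw [← Category.assoc, h2, Category.assoc, sB]
      rw [b1, ← Category.assoc, a2] at b2
      rw [a1, b2, Category.assoc]
    · right
      have a1 : k t ≫ cA = c ≫ prod.fst := by rw [h1, Category.assoc, sA]
      have a2 : prod.map σ (𝟙 _) ≫ k t ≫ cA = c ≫ prod.fst := by
        rw [← Category.assoc, h2, Category.assoc, rA]
      have b1 : k t ≫ cB = (k t ≫ cA) ≫ g := by rw [a1, h1, Category.assoc, sB, Category.assoc]
      have b2 : prod.map σ (𝟙 _) ≫ k t ≫ cB = c ≫ prod.fst ≫ f := by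
        rw [← Category.assoc, h2, Category.assoc, rB]
      rw [b1, ← Category.assoc, a2] at b2
      rw [a1, b2, Category.assoc]
  refine ⟨{t : I // (k t ≫ cA) ≫ f = (k t ≫ cA) ≫ g}, fun t => (Φ ⨯ Φ) ⨯ D t.1,
    fun t => k t.1 ≫ cA, fun t => t.2, ?_⟩
  intro X x hx hne
  have hs : cmk r s (prod.map (𝟙 (Φ ⨯ Φ)) (𝟙 X) ≫ kx x) = cmk r s (prod.map σ (𝟙 X) ≫ kx x) := by
    have h0 : prod.map (𝟙 (Φ ⨯ Φ)) (𝟙 X) ≫ kx x = kx x := by rw [prod.map_id_id, Category.id_comp]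
    let c : (Φ ⨯ Φ) ⨯ X ⟶ A ⨯ (Φ ⨯ Φ) := prod.lift (prod.snd ≫ x) prod.fst
    have h1 : kx x = c ≫ r := by
      apply ext1
      · rw [kA, Category.assoc, rA]
        simp [c, prod.lift_fst, prod.lift_snd, prod.lift_fst_assoc, prod.lift_snd_assoc]
      · rw [kB, Category.assoc, rB]
        simp [c, prod.lift_fst, prod.lift_snd, prod.lift_fst_assoc, prod.lift_snd_assoc]
      · rw [kT, Category.assoc, rT]
        simp [c, prod.lift_fst, prod.lift_snd, prod.lift_fst_assoc, prod.lift_snd_assoc]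
    have h2 : prod.map σ (𝟙 X) ≫ kx x = c ≫ s := by
      apply ext1
      · rw [Category.assoc, kA, Category.assoc, sA]
        simp [c, prod.lift_fst, prod.lift_snd, prod.lift_fst_assoc, prod.lift_snd_assoc]
      · rw [Category.assoc, kB, Category.assoc, sB]
        simp [c, hx, prod.lift_fst, prod.lift_snd, prod.lift_fst_assoc, prod.lift_snd_assoc]
      · rw [Category.assoc, kT, Category.assoc, sT]
        simp [c, prod.lift_fst, prod.lift_snd, prod.lift_fst_assoc, prod.lift_snd_assoc]
    rw [h0, h2, h1]
    exact cmk_sound r s c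
  obtain ⟨t, p, hp⟩ := hy X ⟨cmk r s (kx x), hs⟩
  have hp' : cmk r s (kx x) = cmk r s (prod.map (𝟙 _) p ≫ k t) := by
    have := congrArg Subtype.val hp
    rw [res_EQ, ← hk t] at this
    exact this.symm
  obtain ⟨hA, hT⟩ : (prod.map (𝟙 _) p ≫ k t) ≫ cA = prod.snd ≫ x ∧
      ((prod.map (𝟙 _) p ≫ k t) ≫ cT = prod.fst ∨
        (prod.map (𝟙 _) p ≫ k t) ≫ cT = prod.fst ≫ σ) := by
    rcases eqv _ _ hp' with h1 | ⟨c, ⟨h1, h2⟩ | ⟨h1, h2⟩⟩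
    · rw [← h1, kA, kT]
      exact ⟨rfl, Or.inl rfl⟩
    · rw [h2, ← kA, h1, Category.assoc, Category.assoc, rA, sA]
      refine ⟨rfl, Or.inr ?_⟩
      rw [← kT x, h1, Category.assoc, Category.assoc, Category.assoc, sT, ← Category.assoc r, rT]
    · rw [h2, ← kA, h1, Category.assoc, Category.assoc, rA, sA]
      refine ⟨rfl, Or.inr ?_⟩
      rw [← kT x, h1, Category.assoc, Category.assoc c s, sT, rT, ← Category.assoc c,
        hσ1]
  have hE : (k t ≫ cA) ≫ f = (k t ≫ cA) ≫ g := by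
    rcases hkt t with h1 | h1
    · exfalso
      apply hne
      have comm : prod.map σ (𝟙 X) ≫ prod.map (𝟙 (Φ ⨯ Φ)) p ≫ k t =
          prod.map (𝟙 (Φ ⨯ Φ)) p ≫ k t := by
        conv_rhs => rw [← h1]
        rw [← Category.assoc, ← Category.assoc]
        congr 1
        simp
      have comm2 : prod.map σ (𝟙 X) ≫ (prod.map (𝟙 (Φ ⨯ Φ)) p ≫ k t) ≫ cT =
          (prod.map (𝟙 (Φ ⨯ Φ)) p ≫ k t) ≫ cT := by
        rw [← Category.assoc, comm]
      have fin : (prod.fst : (Φ ⨯ Φ) ⨯ X ⟶ Φ ⨯ Φ) ≫ σ = prod.fst := by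
        rcases hT with e | e
        · rw [e, prod.map_fst] at comm2
          exact comm2
        · rw [e, ← Category.assoc, prod.map_fst, hσ1] at comm2
          exact comm2.symm
      conv_lhs => rw [← fin]
      rw [Category.assoc, hσ2]
    · exact h1
  subst hΦ
  refine ⟨⟨t, hE⟩, prod.lift (prod.lift (prod.lift x (x ≫ f)) (prod.lift x (x ≫ f))) p, ?_⟩
  have e1 : ∀ w : X ⟶ (A ⨯ B) ⨯ (A ⨯ B), prod.lift w p = prod.lift w (𝟙 X) ≫ prod.map (𝟙 _) p := by
    intro w
    simp
  rw [e1, Category.assoc, ← Category.assoc (prod.map _ _), hA, ← Category.assoc, prod.lift_snd,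
    Category.id_comp]
end CaseI

section CaseW
variable {K : Type u} [Category.{v} K] [HasFiniteProducts K]

theorem caseW (h : CartesianClosedP (PCompletion K)) {A B : K} (f g : A ⟶ B) :
    ∃ (I : Type v) (Z : I → K) (e : ∀ t, Z t ⟶ A), (∀ t, e t ≫ f = e t ≫ g) ∧
      ∀ (X : K) (x : X ⟶ A), x ≫ f = x ≫ g →
        (prod.fst ≫ prod.fst : ((A ⨯ B) ⨯ (A ⨯ B)) ⨯ X ⟶ A ⨯ B) = prod.fst ≫ prod.snd →
        ∃ (t : I) (p : X ⟶ Z t), p ≫ e t = x := by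
  let r : A ⟶ A ⨯ B := prod.lift (𝟙 A) f
  let s : A ⟶ A ⨯ B := prod.lift (𝟙 A) g
  have r1 : r ≫ prod.fst = 𝟙 A := prod.lift_fst _ _
  have s1 : s ≫ prod.fst = 𝟙 A := prod.lift_fst _ _
  have r2 : r ≫ prod.snd = f := prod.lift_snd _ _
  have s2 : s ≫ prod.snd = g := prod.lift_snd _ _
  clear_value r s
  have cr1 : ∀ {Y : K} (c : Y ⟶ A), (c ≫ r) ≫ prod.fst = c := by
    intro Y c
    rw [Category.assoc, r1, Category.comp_id]
  have cs1 : ∀ {Y : K} (c : Y ⟶ A), (c ≫ s) ≫ prod.fst = c := by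
    intro Y c
    rw [Category.assoc, s1, Category.comp_id]
  have cr2 : ∀ {Y : K} (c : Y ⟶ A), (c ≫ r) ≫ prod.snd = c ≫ f := by
    intro Y c
    rw [Category.assoc, r2]
  have cs2 : ∀ {Y : K} (c : Y ⟶ A), (c ≫ s) ≫ prod.snd = c ≫ g := by
    intro Y c
    rw [Category.assoc, s2]
  have eqv : ∀ {Y : K} (p q : Y ⟶ A ⨯ B), cmk r s p = cmk r s q →
      p = q ∨ ∃ c : Y ⟶ A, (p = c ≫ r ∧ q = c ≫ s) ∨ (p = c ≫ s ∧ q = c ≫ r) := by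
    intro Y p q
    refine cmk_eq r s ?_ ?_ ?_ p q
    · intro c c' hc
      rw [← cs1 c, hc, cs1]
    · intro c c' hc
      rw [← cr1 c, hc, cr1]
    · intro c c' hc
      have e : c = c' := by rw [← cs1 c, hc, cr1]
      subst e
      exact hc.symm
  -- the two kinds of elements
  let P0 : ∀ (D : K), (Cq r s).obj (op ((A ⨯ B) ⨯ D)) → Prop := fun D w =>
    ∃ k : (A ⨯ B) ⨯ D ⟶ A ⨯ B, cmk r s k = w ∧ prod.map r (𝟙 D) ≫ k = prod.map s (𝟙 D) ≫ k
  let P1 : ∀ (D : K), (Cq r s).obj (op ((A ⨯ B) ⨯ D)) → Prop := fun D w =>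
    ∃ k : (A ⨯ B) ⨯ D ⟶ A ⨯ B, cmk r s k = w ∧ ∃ c : A ⨯ D ⟶ A,
      (prod.map r (𝟙 D) ≫ k = c ≫ r ∧ prod.map s (𝟙 D) ≫ k = c ≫ s) ∨
      (prod.map r (𝟙 D) ≫ k = c ≫ s ∧ prod.map s (𝟙 D) ≫ k = c ≫ r)
  let Deg : K → Prop := fun D => ∃ v : A ⨯ D ⟶ A, v ≫ f = v ≫ g
  have P01 : ∀ (D : K) (w : (EQ r s (Cq r s)).obj (op D)), P0 D w.1 ∨ P1 D w.1 := by
    intro D w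
    obtain ⟨k, hk⟩ := cmk_surj r s w.1
    have e : cmk r s (prod.map r (𝟙 D) ≫ k) = cmk r s (prod.map s (𝟙 D) ≫ k) := by
      have := w.2
      rw [← hk] at this
      exact this
    rcases eqv _ _ e with h1 | h1
    · exact Or.inl ⟨k, hk, h1⟩
    · exact Or.inr ⟨k, hk, h1⟩
  have comm : ∀ {D D' : K} (p : D' ⟶ D) (t : A ⟶ A ⨯ B) (k : (A ⨯ B) ⨯ D ⟶ A ⨯ B),
      prod.map t (𝟙 D') ≫ prod.map (𝟙 _) p ≫ k = prod.map (𝟙 _) p ≫ prod.map t (𝟙 D) ≫ k := by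
    intro D D' p t k
    rw [← Category.assoc, ← Category.assoc]
    congr 1
    simp
  have P0res : ∀ {D D' : K} (p : D' ⟶ D) (w : (EQ r s (Cq r s)).obj (op D)), P0 D w.1 →
      P0 D' (res _ p w).1 := by
    rintro D D' p w ⟨k, hk, h1⟩
    refine ⟨prod.map (𝟙 _) p ≫ k, ?_, ?_⟩
    · rw [res_EQ, ← hk]
      rfl
    · rw [comm, comm, h1]
  have P1res : ∀ {D D' : K} (p : D' ⟶ D) (w : (EQ r s (Cq r s)).obj (op D)), P1 D w.1 →
      P1 D' (res _ p w).1 := by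
    rintro D D' p w ⟨k, hk, c, h1⟩
    refine ⟨prod.map (𝟙 _) p ≫ k, ?_, prod.map (𝟙 _) p ≫ c, ?_⟩
    · rw [res_EQ, ← hk]
      rfl
    · rcases h1 with h1 | h1
      · left
        rw [comm, comm, h1.1, h1.2, Category.assoc, Category.assoc]
        exact ⟨rfl, rfl⟩
      · right
        rw [comm, comm, h1.1, h1.2, Category.assoc, Category.assoc]
        exact ⟨rfl, rfl⟩
  have hDeg : ∀ (D : K) (w : (Cq r s).obj (op ((A ⨯ B) ⨯ D))), P0 D w → P1 D w → Deg D := by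
    rintro D w ⟨k, hk, h0⟩ ⟨k', hk', c, h1⟩
    have e0 : prod.map r (𝟙 D) ≫ k' = prod.map s (𝟙 D) ≫ k' := by
      rcases eqv _ _ (hk.trans hk'.symm) with rfl | ⟨d, ⟨e1, e2⟩ | ⟨e1, e2⟩⟩
      · exact h0
      · have e3 : d = k ≫ prod.fst := by rw [e1, cr1]
        rw [e2, e3, ← Category.assoc, ← Category.assoc, ← Category.assoc, ← Category.assoc, h0]
      · have e3 : d = k ≫ prod.fst := by rw [e1, cs1]
        rw [e2, e3, ← Category.assoc, ← Category.assoc, ← Category.assoc, ← Category.assoc, h0]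
    have e4 : c ≫ r = c ≫ s := by
      rcases h1 with ⟨e1, e2⟩ | ⟨e1, e2⟩
      · rw [← e1, ← e2, e0]
      · rw [← e1, ← e2, e0]
    refine ⟨c, ?_⟩
    rw [← cr2, ← cs2, e4]
  -- two elements
  let ψ : ∀ X : K, (EQ r s (Cq r s)).obj (op X) := fun X => ⟨cmk r s prod.fst, by
    change cmk r s (prod.map r (𝟙 X) ≫ prod.fst) = cmk r s (prod.map s (𝟙 X) ≫ prod.fst)
    rw [prod.map_fst, prod.map_fst]
    exact cmk_sound r s _⟩
  let ψ' : ∀ X : K, (EQ r s (Cq r s)).obj (op X) := fun X =>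
    ⟨cmk r s (prod.fst ≫ prod.fst ≫ r), by
      change cmk r s (prod.map r (𝟙 X) ≫ prod.fst ≫ prod.fst ≫ r) =
        cmk r s (prod.map s (𝟙 X) ≫ prod.fst ≫ prod.fst ≫ r)
      rw [prod.map_fst_assoc, prod.map_fst_assoc, ← Category.assoc r, r1, ← Category.assoc s, s1]⟩
  have hψ : ∀ X, P1 X (ψ X).1 := fun X => ⟨prod.fst, rfl, prod.fst, Or.inl
    ⟨prod.map_fst _ _, prod.map_fst _ _⟩⟩
  have hψ' : ∀ X, P0 X (ψ' X).1 := fun X => ⟨prod.fst ≫ prod.fst ≫ r, rfl, by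
      rw [prod.map_fst_assoc, prod.map_fst_assoc, ← Category.assoc r, r1, ← Category.assoc s, s1]⟩
  have ψres : ∀ {X Y : K} (p : X ⟶ Y), res _ p (ψ Y) = ψ X := by
    intro X Y p
    apply Subtype.ext
    rw [res_EQ]
    change cmk r s (prod.map (𝟙 _) p ≫ prod.fst) = cmk r s prod.fst
    rw [prod.map_fst, Category.comp_id]
  have ψres' : ∀ {X Y : K} (p : X ⟶ Y), res _ p (ψ' Y) = ψ' X := by
    intro X Y p
    apply Subtype.ext
    rw [res_EQ]
    change cmk r s (prod.map (𝟙 _) p ≫ prod.fst ≫ prod.fst ≫ r) = cmk r s (prod.fst ≫ prod.fst ≫ r)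
    rw [prod.map_fst_assoc, Category.id_comp]
  obtain ⟨I, D, E1, E2⟩ := elem_of_isSmall (small_EQ h r s (small_Cq r s))
  have main : ∀ X : K, (ψ X = ψ' X) → Deg (⊤_ K) ∨ ∃ (t : I) (_ : X ⟶ D t), Deg (D t) := by
    intro X hX
    by_contra hcon
    push Not at hcon
    obtain ⟨c1, c2⟩ := hcon
    obtain ⟨t, m, y, hy⟩ := E1 (⊤_ K) (ψ _)
    obtain ⟨t', m', y', hy'⟩ := E1 (⊤_ K) (ψ' _)
    have py : P1 _ y.1 := by
      rcases P01 _ y with h0 | h1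
      · exfalso
        apply c1
        refine hDeg _ _ ?_ (hψ _)
        rw [← hy]
        exact P0res m y h0
      · exact h1
    have py' : P0 _ y'.1 := by
      rcases P01 _ y' with h0 | h1
      · exact h0
      · exfalso
        apply c1
        refine hDeg _ _ (hψ' _) ?_
        rw [← hy']
        exact P1res m' y' h1
    have := E2 X (fun t _ y => P1 (D t) y.1) (by
      intro t t' w p y
      constructor
      · intro h1
        rcases P01 _ y with h0 | h0
        · exact absurd (hDeg _ _ (P0res w y h0) h1) (c2 t p)
        · exact h0
      · intro h1
        exact P1res w y h1) t t' (terminal.from X ≫ m) (terminal.from X ≫ m') y y' (by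
          rw [res_comp, res_comp, hy, hy', ψres, ψres', hX]) py
    exact c2 t' (terminal.from X ≫ m') (hDeg _ _ py' this)
  refine ⟨(Σ t : I, {v : A ⨯ D t ⟶ A // v ≫ f = v ≫ g}) ⊕ {v : A ⨯ (⊤_ K) ⟶ A // v ≫ f = v ≫ g},
    fun t => Sum.rec (fun t => A ⨯ D t.1) (fun _ => A ⨯ (⊤_ K)) t,
    fun t => Sum.rec (motive := fun t => (Sum.rec (fun t => A ⨯ D t.1) (fun _ => A ⨯ (⊤_ K)) t : K) ⟶ A)
      (fun t => t.2.1) (fun t => t.1) t, ?_, ?_⟩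
  · rintro (t | t)
    · exact t.2.2
    · exact t.2
  · intro X x hx htriv
    have tr : ∀ {Y : K} (_ : Y ⟶ X) (a b : Y ⟶ A ⨯ B), a = b := by
      intro Y q a b
      have e1 : prod.lift (prod.lift a b) q ≫ prod.fst ≫ prod.fst = a := by
        rw [← Category.assoc, prod.lift_fst, prod.lift_fst]
      have e2 : prod.lift (prod.lift a b) q ≫ prod.fst ≫ prod.snd = b := by
        rw [← Category.assoc, prod.lift_fst, prod.lift_snd]
      rw [← e1, htriv, e2]
    have tr' : ∀ a b : X ⟶ A, a = b := by
      intro a b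
      rw [← cr1 a, tr (𝟙 X) (a ≫ r) (b ≫ r), cr1]
    have hX : ψ X = ψ' X := Subtype.ext (congrArg (cmk r s) (tr prod.snd _ _))
    rcases main X hX with ⟨v, hv⟩ | ⟨t, p, v, hv⟩
    · exact ⟨Sum.inr ⟨v, hv⟩, prod.lift x (terminal.from X), tr' _ _⟩
    · exact ⟨Sum.inl ⟨t, v, hv⟩, prod.lift x p, tr' _ _⟩

theorem fp_of_closed (h : CartesianClosedP (PCompletion K)) : FP K := by
  intro A B f g
  obtain ⟨I, Z, e, h1, h2⟩ := caseI h f g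
  obtain ⟨I', Z', e', h1', h2'⟩ := caseW h f g
  refine ⟨I ⊕ I', fun t => Sum.rec Z Z' t,
    fun t => Sum.rec (motive := fun t => (Sum.rec Z Z' t : K) ⟶ A) e e' t, ?_, ?_⟩
  · rintro (t | t)
    · exact h1 t
    · exact h1' t
  · intro X x hx
    by_cases hc : (prod.fst ≫ prod.fst : ((A ⨯ B) ⨯ (A ⨯ B)) ⨯ X ⟶ A ⨯ B) = prod.fst ≫ prod.snd
    · obtain ⟨t, p, hp⟩ := h2' X x hx hc
      exact ⟨Sum.inr t, p, hp⟩
    · obtain ⟨t, p, hp⟩ := h2 X x hx hc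
      exact ⟨Sum.inl t, p, hp⟩
end CaseW

section PreC
variable {K : Type u} [Category.{v} K]

/-- coproduct of representables -/
def SigP {I : Type v} (Z : I → K) : Kᵒᵖ ⥤ Type v where
  obj X := Σ i, (X.unop ⟶ Z i)
  map f := TypeCat.ofHom fun y => ⟨y.1, f.unop ≫ y.2⟩
  map_id X := by
    apply ConcreteCategory.hom_ext
    intro y
    exact congrArg (fun b : X.unop ⟶ Z y.1 => (⟨y.1, b⟩ : Σ i, (X.unop ⟶ Z i))) (Category.id_comp y.2)
  map_comp {X Y W} f g := by
    apply ConcreteCategory.hom_ext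
    intro y
    exact congrArg (fun b : W.unop ⟶ Z y.1 => (⟨y.1, b⟩ : Σ i, (W.unop ⟶ Z i)))
      (Category.assoc g.unop f.unop y.2)

/-- elements -/
def smk {I : Type v} (Z : I → K) {X : K} (i : I) (b : X ⟶ Z i) : (SigP Z).obj (op X) := ⟨i, b⟩

theorem res_smk {I : Type v} (Z : I → K) {X Y : K} (p : X ⟶ Y) (i : I) (b : Y ⟶ Z i) :
    res (SigP Z) p (smk Z i b) = smk Z i (p ≫ b) := rfl

theorem smk_surj {I : Type v} (Z : I → K) {X : K} (y : (SigP Z).obj (op X)) :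
    ∃ i b, smk Z i b = y := ⟨y.1, y.2, rfl⟩

theorem smk_inj {I : Type v} (Z : I → K) {X : K} {i : I} {b b' : X ⟶ Z i}
    (h : smk Z i b = smk Z i b') : b = b' := by
  have := Sigma.mk.inj h
  exact eq_of_heq this.2

theorem smk_idx {I : Type v} (Z : I → K) {X : K} {i j : I} {b : X ⟶ Z i} {b' : X ⟶ Z j}
    (h : smk Z i b = smk Z j b') : i = j := (Sigma.mk.inj h).1

theorem small_SigP {I : Type v} (Z : I → K) : IsSmallPresheaf.{v} (SigP Z) := by
  refine isSmall_of_elem ⟨I, Z, ?_, ?_⟩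
  · intro X x
    obtain ⟨i, b, rfl⟩ := smk_surj Z x
    exact ⟨i, b, smk Z i (𝟙 _), by rw [res_smk, Category.comp_id]⟩
  · intro X Q hQ t t' p p' y y' he hq
    have h1 : ∀ (t i : I) (p : X ⟶ Z t) (b : Z t ⟶ Z i),
        Q t p (smk Z i b) ↔ Q i (p ≫ b) (smk Z i (𝟙 _)) := by
      intro t i p b
      have := hQ t i b p (smk Z i (𝟙 _))
      rwa [res_smk, Category.comp_id] at this
    obtain ⟨i, b, rfl⟩ := smk_surj Z y
    obtain ⟨i', b', rfl⟩ := smk_surj Z y'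
    rw [res_smk, res_smk] at he
    obtain rfl := smk_idx Z he
    rw [h1] at hq ⊢
    rwa [← smk_inj Z he]

variable [HasFiniteProducts K]

theorem preComplete_of_closed (h : CartesianClosedP (PCompletion K)) : PreComplete K := by
  intro J _ D
  obtain ⟨T, W, y, hy⟩ := petty_of_isSmall (small_POW h J (small_SigP D.obj))
  let T' := {t : T // ∃ a : ∀ j, W t ⟶ D.obj j, ∀ j, y t j = smk D.obj j (a j)}
  let U := Σ (j j' : J), (j ⟶ j')
  let Z : U → K := fun w => D.obj w.2.1
  choose a ha using fun t : T' => t.2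
  have lu := (lucid_of_isSmall (fp_of_closed h) (small_POW h U (small_SigP Z))).2
  choose I C e he1 he2 using fun t : T' => lu (W t.1)
    (fun w => smk Z w (a t w.1 ≫ D.map w.2.2)) (fun w => smk Z w (a t w.2.1))
  refine ⟨Σ t : T', I t, fun s =>
    { pt := C s.1 s.2
      π := { app := fun j => e s.1 s.2 ≫ a s.1 j
             naturality := fun j j' w => ?_ } }, ?_⟩
  · have h1 := congrFun (he1 s.1 s.2) ⟨j, j', w⟩
    have h2 : smk Z ⟨j, j', w⟩ (e s.1 s.2 ≫ a s.1 j ≫ D.map w) =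
      smk Z ⟨j, j', w⟩ (e s.1 s.2 ≫ a s.1 j') := h1
    have h3 := smk_inj Z h2
    change 𝟙 _ ≫ e s.1 s.2 ≫ a s.1 j' = (e s.1 s.2 ≫ a s.1 j) ≫ D.map w
    rw [Category.id_comp, Category.assoc]
    exact h3.symm
  · intro s
    obtain ⟨t, p, hp⟩ := hy s.pt (fun j => smk D.obj j (s.π.app j))
    have h1 : ∀ j, ∃ b : W t ⟶ D.obj j, y t j = smk D.obj j b ∧ p ≫ b = s.π.app j := by
      intro j
      obtain ⟨i, b, hb⟩ := smk_surj D.obj (y t j)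
      have h2 : res (SigP D.obj) p (y t j) = smk D.obj j (s.π.app j) := congrFun hp j
      rw [← hb, res_smk] at h2
      obtain rfl := smk_idx D.obj h2
      exact ⟨b, hb.symm, smk_inj D.obj h2⟩
    choose b hb1 hb2 using h1
    let t' : T' := ⟨t, b, hb1⟩
    have hab : ∀ j, a t' j = b j := fun j => smk_inj D.obj ((ha t' j).symm.trans (hb1 j))
    have hpa : ∀ j, p ≫ a t' j = s.π.app j := fun j =>
      (congrArg (fun q => p ≫ q) (hab j)).trans (hb2 j)
    obtain ⟨i, q, hq⟩ := he2 t' s.pt p (by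
      funext w
      change smk Z w (p ≫ a t' w.1 ≫ D.map w.2.2) = smk Z w (p ≫ a t' w.2.1)
      rw [hpa, ← Category.assoc, hpa, s.w])
    refine ⟨⟨t', i⟩, ⟨{ hom := q, w := fun j => ?_ }⟩⟩
    change q ≫ e t' i ≫ a t' j = s.π.app j
    rw [← Category.assoc, hq, hpa]
end PreC

/-- Theorem 3.11: for `𝒦` with finite products, `𝒫𝒦` is cartesian
closed iff `𝒦` is pre-complete and cartesian pre-closed. -/
theorem pCompletion_cartesianClosed_iff (K : Type u) [Category.{v} K]
    [HasFiniteProducts K] :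
    CartesianClosedP (PCompletion K) ↔ PreComplete K ∧ CartesianPreClosedOf.{v} K := by
  exact ⟨fun h => ⟨preComplete_of_closed h, preClosed_of_closed h⟩,
    fun h => closed_of_pre h.1 h.2⟩
end FreeCompletions
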